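/- arXiv:1309.7662 — 2 statements merged into one kernel-verified Lean document; each statement's English description precedes it below -/
import Mathlib

section
/- For a finite group H with conjugacy classes C_1,...,C_k and an integer g ≥ 0, the number of tuples (a_1,b_1,...,a_g,b_g,x_1,...,x_k) in H^{2g} × C_1 × ... × C_k with [a_1,b_1]···[a_g,b_g]·x_1···x_k = 1 equals |H| · Σ_{χ ∈ Irr(H)} (|H|/χ(1))^{2g-2} · Π_{i=1}^k (|C_i| χ(c_i) / χ(1)), where c_i ∈ C_i. -/
/-!
STATEMENT 0 (Frobenius formula): For a finite group `H` with conjugacy classes `C₁, …, C_k`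
and `g ≥ 0`, the number of tuples `(a₁,b₁,…,a_g,b_g,x₁,…,x_k) ∈ H^{2g} × C₁ × ⋯ × C_k` with
`[a₁,b₁]⋯[a_g,b_g]·x₁⋯x_k = 1` equals
`|H| · Σ_{χ ∈ Irr(H)} (|H|/χ(1))^{2g-2} · Π_i (|C_i| χ(c_i) / χ(1))`.

Irreducible characters are encoded by a finite family `V : ι → FDRep ℂ H` of pairwise
non-isomorphic irreducible representations containing every irreducible representation
up to isomorphism, so that `(V i).character` runs over `Irr(H)`.
-/

open CategoryTheory

noncomputable section

/-- the commutator `[a, b] = a b a⁻¹ b⁻¹` -/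
def commutator' {H : Type*} [Group H] (a b : H) : H := a * b * a⁻¹ * b⁻¹

/-- Schur's lemma for endomorphisms, with the scalar expressed through the trace. -/
lemma FDRep.eq_trace_div_smul_one {H : Type} [Group H] [Fintype H] (V : FDRep ℂ H) [Simple V]
    (T : V →ₗ[ℂ] V) (hT : ∀ h, V.ρ h * T = T * V.ρ h) :
    V.character 1 ≠ 0 ∧ T = (LinearMap.trace ℂ V T / V.character 1) • (1 : V →ₗ[ℂ] V) := by
  have hinv (S : V →ₗ[ℂ] V) (hS : ∀ h, V.ρ h * S = S * V.ρ h) :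
      S ∈ Representation.invariants (Representation.linHom V.ρ V.ρ) :=
    fun h => by
      change V.ρ h * (S * V.ρ h⁻¹) = S
      rw [← mul_assoc, hS, mul_assoc, ← map_mul, mul_inv_cancel, map_one, mul_one]
  have hrank : Module.finrank ℂ (Representation.invariants (Representation.linHom V.ρ V.ρ)) = 1 :=
    (LinearEquiv.finrank_eq (Representation.linHom.invariantsEquivFDRepHom V V)).trans
      (finrank_endomorphism_simple_eq_one ℂ V)
  have hone : (1 : V →ₗ[ℂ] V) ≠ 0 := by
    intro h0
    have hzero (S : V →ₗ[ℂ] V) : S = 0 := by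
      rw [← one_mul S, h0, zero_mul]
    have : Subsingleton (Representation.invariants (Representation.linHom V.ρ V.ρ)) :=
      ⟨fun a b => Subtype.ext ((hzero _).trans (hzero _).symm)⟩
    rw [Module.finrank_zero_of_subsingleton] at hrank
    exact zero_ne_one hrank
  have hdim : V.character 1 ≠ 0 := by
    rw [FDRep.char_one]
    intro h0
    have : Subsingleton V := Module.finrank_zero_iff.1 (by exact_mod_cast h0)
    exact hone (LinearMap.ext fun x => Subsingleton.elim _ _)
  refine ⟨hdim, ?_⟩
  obtain ⟨c, hc⟩ := (finrank_eq_one_iff_of_nonzero'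
    (⟨1, hinv 1 fun h => by rw [mul_one, one_mul]⟩ :
      Representation.invariants (Representation.linHom V.ρ V.ρ))
    (fun h => hone (congrArg Subtype.val h))).1 hrank ⟨T, hinv T hT⟩
  have hT' : T = c • (1 : V →ₗ[ℂ] V) := (congrArg Subtype.val hc).symm
  have htr : LinearMap.trace ℂ V T = c * V.character 1 := by
    rw [hT', map_smul, smul_eq_mul, FDRep.char_one, LinearMap.trace_one]
  rw [htr, mul_div_cancel_right₀ _ hdim]
  exact hT'

lemma FDRep.character_one_ne_zero {H : Type} [Group H] [Fintype H] (V : FDRep ℂ H) [Simple V] :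
    V.character 1 ≠ 0 :=
  (V.eq_trace_div_smul_one 0 fun _ => by rw [mul_zero, zero_mul]).1

lemma FDRep.sum_class_function_smul {H : Type} [Group H] [Fintype H] (V : FDRep ℂ H) [Simple V]
    (w : H → ℂ) (hw : ∀ h x, w (h * x * h⁻¹) = w x) :
    ∑ x, w x • V.ρ x = ((∑ x, w x * V.character x) / V.character 1) • (1 : V →ₗ[ℂ] V) := by
  have hcomm (h : H) : V.ρ h * (∑ x, w x • V.ρ x) = (∑ x, w x • V.ρ x) * V.ρ h := by
    rw [Finset.mul_sum, Finset.sum_mul]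
    refine Fintype.sum_equiv (MulAut.conj h).toEquiv _ _ fun x => ?_
    simp [hw, ← map_mul]
  rw [(V.eq_trace_div_smul_one _ hcomm).2, map_sum]
  simp [FDRep.character]

lemma FDRep.sum_character_mul_character_inv {H : Type} [Group H] [Fintype H]
    (V : FDRep ℂ H) [hV : Simple V] :
    ∑ x, V.character x⁻¹ * V.character x = Fintype.card H := by
  simpa [mul_comm] using V.simple_iff_char_is_norm_one.1 hV

lemma FDRep.sum_commutator {H : Type} [Group H] [Fintype H] (V : FDRep ℂ H) [Simple V] :
    ∑ p : H × H, V.ρ (commutator' p.1 p.2) =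
      ((Fintype.card H : ℂ) / V.character 1) ^ 2 • (1 : V →ₗ[ℂ] V) := by
  have hd := V.character_one_ne_zero
  have hconj (b : H) : ∑ a, V.ρ (a * b * a⁻¹) =
      (Fintype.card H * V.character b / V.character 1) • (1 : V →ₗ[ℂ] V) := by
    have hcomm (h : H) : V.ρ h * (∑ a, V.ρ (a * b * a⁻¹)) =
        (∑ a, V.ρ (a * b * a⁻¹)) * V.ρ h := by
      rw [Finset.mul_sum, Finset.sum_mul]
      refine Fintype.sum_equiv (Equiv.mulLeft h) _ _ fun a => ?_
      simp only [← map_mul, Equiv.coe_mulLeft]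
      congr 1
      group
    rw [(V.eq_trace_div_smul_one _ hcomm).2, map_sum]
    congr 2
    simp_rw [← FDRep.character.eq_def, FDRep.char_conj]
    simp
  calc ∑ p : H × H, V.ρ (commutator' p.1 p.2)
      = ∑ b, (∑ a, V.ρ (a * b * a⁻¹)) * V.ρ b⁻¹ := by
        simp_rw [Fintype.sum_prod_type_right, Finset.sum_mul, ← map_mul, commutator']
    _ = ∑ b, (Fintype.card H * V.character b⁻¹ / V.character 1) • V.ρ b := by
        refine Fintype.sum_equiv (Equiv.inv H) _ _ fun b => ?_
        rw [hconj, smul_mul_assoc, one_mul, Equiv.inv_apply, inv_inv]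
    _ = _ := by
        rw [V.sum_class_function_smul]
        · congr 1
          have := V.sum_character_mul_character_inv
          simp_rw [div_mul_eq_mul_div, ← Finset.sum_div, mul_assoc, ← Finset.mul_sum, this]
          field_simp
        · intro h x
          rw [show (h * x * h⁻¹)⁻¹ = h * x⁻¹ * h⁻¹ by group, FDRep.char_conj]

lemma FDRep.sum_isConj {H : Type} [Group H] [Fintype H] (V : FDRep ℂ H) [Simple V] (c : H) :
    ∑ x, ({h : H | IsConj c h}.indicator 1 x : ℂ) • V.ρ x =
      (Nat.card {h : H | IsConj c h} * V.character c / V.character 1) • (1 : V →ₗ[ℂ] V) := by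
  classical
  rw [V.sum_class_function_smul]
  · congr 2
    have hterm (x : H) : ({h : H | IsConj c h}.indicator 1 x : ℂ) * V.character x =
        {h : H | IsConj c h}.indicator 1 x * V.character c := by
      by_cases hx : IsConj c x
      · obtain ⟨h, rfl⟩ := isConj_iff.1 hx
        rw [FDRep.char_conj]
      · rw [Set.indicator_of_notMem (by exact hx), zero_mul, zero_mul]
    simp_rw [hterm, ← Finset.sum_mul, Set.indicator_apply]
    simp [Nat.card_eq_fintype_card, Fintype.card_subtype]
  · intro h x
    have : IsConj c (h * x * h⁻¹) ↔ IsConj c x :=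
      ⟨fun hx => hx.trans (isConj_iff.2 ⟨h⁻¹, by group⟩), fun hx => hx.trans (isConj_iff.2 ⟨h, rfl⟩)⟩
    simp only [Set.indicator_apply, Set.mem_ofPred_eq, this, Pi.one_apply]

/-- A sum over tuples of a multiplicative function of an ordered product factors as soon as
each individual factor sums to a scalar. -/
lemma sum_smul_map_list_ofFn_prod {M A R α : Type*} [Monoid M] [CommSemiring R] [Semiring A]
    [Algebra R A] [Fintype α] (φ : M →* A) (n : ℕ) (w : Fin n → α → R) (f : Fin n → α → M)
    (s : Fin n → R) (hs : ∀ i, ∑ a, w i a • φ (f i a) = s i • (1 : A)) :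
    ∑ t : Fin n → α, (∏ i, w i (t i)) • φ (List.ofFn fun i => f i (t i)).prod =
      (∏ i, s i) • (1 : A) := by
  induction n with
  | zero => simp
  | succ n ih =>
    rw [← (Fin.consEquiv fun _ => α).sum_comp, Fintype.sum_prod_type]
    have ih' := ih (fun i => w i.succ) (fun i => f i.succ) (fun i => s i.succ) fun i => hs i.succ
    simp only [Fin.consEquiv, Equiv.coe_fn_mk, Fin.prod_univ_succ, Fin.cons_zero, Fin.cons_succ,
      List.ofFn_succ, List.prod_cons, map_mul]
    simp_rw [← smul_mul_smul_comm, ← Finset.mul_sum, ih', ← Finset.sum_mul, hs 0,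
      smul_mul_smul_comm, mul_one]

lemma RestrictScalars.finite_of_finite {R A : Type*} [CommSemiring R] [Semiring A] [Algebra R A]
    [Module.Finite R A] (M : Type*) [AddCommMonoid M] [Module A M] [Module.Finite A M] :
    Module.Finite R (RestrictScalars R A M) := by
  let : Module A (RestrictScalars R A M) := RestrictScalars.moduleOrig R A M
  have : Module.Finite A (RestrictScalars R A M) := inferInstanceAs (Module.Finite A M)
  exact Module.Finite.trans A _

lemma MonoidAlgebra.smul_eq_zero_of_forall_simple {H : Type} [Group H] [Fintype H]
    {z : MonoidAlgebra ℂ H}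
    (hz : ∀ W : FDRep ℂ H, Simple W → Representation.asAlgebraHom W.ρ z = 0)
    {M : Type} [AddCommGroup M] [Module (MonoidAlgebra ℂ H) M]
    [IsSimpleModule (MonoidAlgebra ℂ H) M] (m : M) : z • m = 0 := by
  let : @Module ℂ (RestrictScalars ℂ (MonoidAlgebra ℂ H) M) _ AddCommGroup.toAddCommMonoid :=
    RestrictScalars.module ℂ _ M
  let σ : Representation ℂ H (RestrictScalars ℂ (MonoidAlgebra ℂ H) M) :=
    Representation.ofModule M
  have : σ.IsIrreducible :=
    (Representation.isSimpleModule_iff_irreducible_ofModule _).1 inferInstance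
  have : FiniteDimensional ℂ (RestrictScalars ℂ (MonoidAlgebra ℂ H) M) :=
    RestrictScalars.finite_of_finite M
  have hW : Simple (FDRep.of σ) := by
    rw [FDRep.simple_iff_char_is_norm_one]
    have := invertibleOfNonzero (NeZero.ne (Nat.card H : ℂ))
    have h := Representation.char_orthonormal σ σ
    rw [if_pos ⟨Representation.Equiv.refl σ⟩, inv_mul_eq_one₀ (NeZero.ne _)] at h
    exact h.symm
  have h := LinearMap.congr_fun (hz _ hW)
    ((RestrictScalars.addEquiv ℂ (MonoidAlgebra ℂ H) M).symm m)
  have h' := (Representation.ofModule_asAlgebraHom_apply_apply M z _).symm.trans h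
  simpa using h'

lemma MonoidAlgebra.eq_zero_of_forall_simple {H : Type} [Group H] [Fintype H]
    {z : MonoidAlgebra ℂ H}
    (hz : ∀ W : FDRep ℂ H, Simple W → Representation.asAlgebraHom W.ρ z = 0) : z = 0 := by
  have hmem : z ∈ Ring.jacobson (MonoidAlgebra ℂ H) := by
    rw [Ring.jacobson, Module.jacobson, Submodule.mem_sInf]
    intro I hI
    have : IsSimpleModule (MonoidAlgebra ℂ H) (MonoidAlgebra ℂ H ⧸ I) :=
      isSimpleModule_iff_isCoatom.2 hI
    have h := MonoidAlgebra.smul_eq_zero_of_forall_simple hz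
      (Submodule.Quotient.mk 1 : MonoidAlgebra ℂ H ⧸ I)
    rwa [← Submodule.Quotient.mk_smul, Submodule.Quotient.mk_eq_zero, smul_eq_mul, mul_one] at h
  rwa [IsSemisimpleRing.jacobson_eq_bot] at hmem

lemma sum_irreducible_character_one_mul {H : Type} [Group H] [Fintype H] [DecidableEq H]
    {ι : Type} [Fintype ι] (V : ι → FDRep ℂ H)
    (hsimple : ∀ i, Simple (V i))
    (hdistinct : ∀ i j, i ≠ j → IsEmpty (V i ≅ V j))
    (hcomplete : ∀ W : FDRep ℂ H, Simple W → ∃ i, Nonempty (W ≅ V i)) (h : H) :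
    ∑ i, (V i).character 1 * (V i).character h = if h = 1 then (Fintype.card H : ℂ) else 0 := by
  classical
  have horth (i j : ι) : ∑ x, (V i).character x⁻¹ * (V j).character x =
      if i = j then (Fintype.card H : ℂ) else 0 := by
    have := hsimple i
    have := hsimple j
    split_ifs with hij
    · subst hij
      exact (V i).sum_character_mul_character_inv
    · have := invertibleOfNonzero (NeZero.ne (Nat.card H : ℂ))
      have ho := FDRep.char_orthonormal (V j) (V i)
      rw [if_neg (not_nonempty_iff.2 (hdistinct j i (Ne.symm hij)))] at ho
      simpa [mul_comm] using ho
  let f : H → ℂ := fun x =>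
    (if x = 1 then (Fintype.card H : ℂ) else 0) - ∑ i, (V i).character 1 * (V i).character x⁻¹
  have hf (h x : H) : f (h * x * h⁻¹) = f x := by
    simp only [f, conj_eq_one_iff, conj_inv, FDRep.char_conj]
  have hz : ∑ x, MonoidAlgebra.single x (f x) = 0 := by
    refine MonoidAlgebra.eq_zero_of_forall_simple fun W hW => ?_
    obtain ⟨j, ⟨e⟩⟩ := hcomplete W hW
    simp only [map_sum, Representation.asAlgebraHom_single]
    rw [W.sum_class_function_smul f hf, FDRep.char_iso e]
    convert zero_smul ℂ _
    rw [div_eq_zero_iff]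
    left
    simp only [f, sub_mul, Finset.sum_sub_distrib, Finset.sum_mul]
    rw [Finset.sum_comm]
    simp_rw [mul_assoc, ← Finset.mul_sum, horth]
    simp [mul_comm]
  have hh : f h⁻¹ = 0 := by
    have := congrArg (fun z : MonoidAlgebra ℂ H => z.coeff h⁻¹) hz
    simpa [Finsupp.single_apply] using this
  simp only [f, inv_inv, inv_eq_one, sub_eq_zero] at hh
  exact hh.symm

theorem frobenius_formula
    (H : Type) [Group H] [Fintype H]
    (g k : ℕ)
    (ι : Type) [Fintype ι] (V : ι → FDRep ℂ H)
    (hsimple : ∀ i, Simple (V i))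
    (hdistinct : ∀ i j, i ≠ j → IsEmpty (V i ≅ V j))
    (hcomplete : ∀ W : FDRep ℂ H, Simple W → ∃ i, Nonempty (W ≅ V i))
    (c : Fin k → H) (C : Fin k → Set H) (hC : ∀ j, C j = {h : H | IsConj (c j) h}) :
    (Nat.card {t : (Fin g → H) × (Fin g → H) × (Fin k → H) //
        (∀ j, t.2.2 j ∈ C j) ∧
        ((List.ofFn fun i => commutator' (t.1 i) (t.2.1 i)) ++
          (List.ofFn fun j => t.2.2 j)).prod = 1} : ℂ)
      = (Fintype.card H : ℂ) *
          ∑ i : ι, ((Fintype.card H : ℂ) / (V i).character 1) ^ (2 * (g : ℤ) - 2) *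
            ∏ j : Fin k,
              ((Nat.card (C j) : ℂ) * (V i).character (c j) / (V i).character 1) := by
  classical
  have hH : (Fintype.card H : ℂ) ≠ 0 := Nat.cast_ne_zero.2 Fintype.card_ne_zero
  let word (p : Fin g → H × H) : H := (List.ofFn fun i => commutator' (p i).1 (p i).2).prod
  let wt (x : Fin k → H) : ℂ := ∏ j, (C j).indicator 1 (x j)
  have hwt (x : Fin k → H) : wt x = if ∀ j, x j ∈ C j then 1 else 0 := by
    simp only [wt, Set.indicator_apply, Pi.one_apply]
    simp [Finset.prod_ite_zero]
  have hcount : (Nat.card {t : (Fin g → H) × (Fin g → H) × (Fin k → H) //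
        (∀ j, t.2.2 j ∈ C j) ∧
        ((List.ofFn fun i => commutator' (t.1 i) (t.2.1 i)) ++
          (List.ofFn fun j => t.2.2 j)).prod = 1} : ℂ) =
      ∑ p, ∑ x, wt x * if word p * (List.ofFn x).prod = 1 then 1 else 0 := by
    rw [Nat.card_eq_fintype_card, Fintype.card_subtype, Finset.card_filter, Nat.cast_sum,
      ← (Equiv.prodAssoc _ _ _).sum_comp, Fintype.sum_prod_type,
      ← (Equiv.arrowProdEquivProdArrow (Fin g) (fun _ => H) (fun _ => H)).sum_comp]
    refine Finset.sum_congr rfl fun p _ => Finset.sum_congr rfl fun x _ => ?_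
    simp only [hwt, word, Equiv.arrowProdEquivProdArrow, Equiv.prodAssoc_apply, Equiv.coe_fn_mk,
      List.prod_append, ite_and, ite_mul, one_mul, zero_mul]
    push_cast
    rfl
  have htrace (i : ι) : ∑ p, ∑ x, wt x * (V i).character (word p * (List.ofFn x).prod) =
      ((Fintype.card H : ℂ) / (V i).character 1) ^ (2 * g) *
        (∏ j, ((Nat.card (C j) : ℂ) * (V i).character (c j) / (V i).character 1)) *
        (V i).character 1 := by
    have := hsimple i
    have hcomm := sum_smul_map_list_ofFn_prod (R := ℂ) (V i).ρ g (fun _ _ => 1)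
      (fun _ (p : H × H) => commutator' p.1 p.2) _
      fun _ => by simpa only [one_smul] using (V i).sum_commutator
    have hclass := sum_smul_map_list_ofFn_prod (R := ℂ) (V i).ρ k (fun j => (C j).indicator 1)
      (fun _ (x : H) => x)
      (fun j => (Nat.card (C j) : ℂ) * (V i).character (c j) / (V i).character 1)
      fun j => by rw [hC j]; exact (V i).sum_isConj (c j)
    have hmul := congrArg (LinearMap.trace ℂ (V i)) (congrArg₂ (· * ·) hcomm hclass)
    simp only [Finset.prod_const_one, one_smul, Finset.sum_mul_sum, mul_smul_comm, ← map_mul,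
      map_sum, map_smul, smul_eq_mul, mul_one, LinearMap.trace_one,
      Finset.prod_const, Finset.card_univ, Fintype.card_fin, ← pow_mul] at hmul
    rw [← (V i).char_one, mul_left_comm, ← mul_assoc] at hmul
    exact hmul
  have hdelta (h : H) : (if h = 1 then 1 else 0 : ℂ) =
      (Fintype.card H : ℂ)⁻¹ * ∑ i, (V i).character 1 * (V i).character h := by
    rw [sum_irreducible_character_one_mul V hsimple hdistinct hcomplete]
    split_ifs <;> simp [hH]
  calc _ = ∑ i, (Fintype.card H : ℂ)⁻¹ * (V i).character 1 *
        ∑ p, ∑ x, wt x * (V i).character (word p * (List.ofFn x).prod) := by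
        rw [hcount]
        simp_rw [hdelta, Finset.mul_sum]
        rw [Finset.sum_congr rfl fun p _ => Finset.sum_comm, Finset.sum_comm]
        refine Finset.sum_congr rfl fun i _ => Finset.sum_congr rfl fun p _ =>
          Finset.sum_congr rfl fun x _ => ?_
        ring
    _ = _ := by
        rw [Finset.mul_sum]
        refine Finset.sum_congr rfl fun i _ => ?_
        have := hsimple i
        have hd := (V i).character_one_ne_zero
        rw [htrace, zpow_sub₀ (div_ne_zero hH hd)]
        norm_cast
        field_simp
end
end

section
/- The orthogonality relations for Green polynomials: for partitions ρ, σ of n, Σ_λ 𝓗_λ(q) Q^λ_ρ(q) Q^λ_σ(q) = δ_{ρσ} y_ρ(q), where Q^λ_ρ(q) = Σ_μ χ^μ_ρ K̃_{μλ}(q), 𝓗_λ(q) = 1/a_λ(q) with a_λ(q) the order of the centralizer of a unipotent element of Jordan type λ in GL_n(F_q), and y_ρ(q) = q^{-n} z_ρ Π_i (1 - q^{-ρ_i})^{-1}. -/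
noncomputable section

open MvPolynomial Finset

/-- the field `ℚ(q)` of coefficients -/
abbrev K : Type := RatFunc ℚ

/-- the indeterminate `q` -/
def q : K := RatFunc.X

/-- the ring of symmetric functions, presented as the polynomial ring on the power sums:
the variable `i` stands for `p_{i+1}` -/
abbrev SymF : Type := MvPolynomial ℕ K

/-- `p_ρ` -/
def pP {n : ℕ} (ρ : n.Partition) : SymF := (ρ.parts.map fun i => (X (i - 1) : SymF)).prod

/-- `z_ρ = Π_i i^{m_i} m_i!` -/
def zP {n : ℕ} (ρ : n.Partition) : ℕ :=
  ∏ i ∈ ρ.parts.toFinset, i ^ ρ.parts.count i * (ρ.parts.count i).factorial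

/-- the `z`-factor of a power-sum monomial -/
def zMon (d : ℕ →₀ ℕ) : K :=
  ∏ i ∈ d.support, (((i + 1) ^ d i * (d i).factorial : ℕ) : K)

/-- the Hall pairing, determined by `⟨p_λ, p_μ⟩ = δ_{λμ} z_λ` -/
def hall (f g : SymF) : K := ∑ d ∈ f.support, coeff d f * coeff d g * zMon d

/-- the complete homogeneous function `h_m = Σ_{ρ ⊢ m} z_ρ⁻¹ p_ρ` -/
def hP (m : ℕ) : SymF := ∑ ρ : m.Partition, ((zP ρ : K)⁻¹) • pP ρ

/-- `h_m` for `m : ℤ`, vanishing for `m < 0` -/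
def hZ (m : ℤ) : SymF := if m < 0 then 0 else hP m.toNat

/-- the parts of a partition, as a weakly decreasing list -/
def sortedParts {n : ℕ} (lam : n.Partition) : List ℕ := (lam.parts.sort (· ≤ ·)).reverse

/-- the Schur function `s_λ`, via the Jacobi–Trudi determinant
`s_λ = det(h_{λ_i - i + j})` -/
def schur {n : ℕ} (lam : n.Partition) : SymF :=
  Matrix.det (Matrix.of fun i j : Fin (sortedParts lam).length =>
    hZ (((sortedParts lam).get i : ℤ) - (i : ℤ) + (j : ℤ)))

/-- the character value `χ^μ_ρ` of the symmetric group, via the Frobenius characteristic: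
`χ^μ_ρ = ⟨s_μ, p_ρ⟩` -/
def chiS {n : ℕ} (μ ρ : n.Partition) : K := hall (schur μ) (pP ρ)

/-- `n(λ) = Σ (i-1) λ_i` -/
def nStat {n : ℕ} (lam : n.Partition) : ℕ :=
  ∑ i ∈ Finset.range (sortedParts lam).length, i * (sortedParts lam).getD i 0

/-- `a_λ(q)`, the order of the centralizer in `GL_n(F_q)` of a unipotent element of Jordan
type `λ`: `a_λ(q) = q^{|λ| + 2n(λ)} Π_i Π_{k=1}^{m_i} (1 - q^{-k})` -/
def aP {n : ℕ} (lam : n.Partition) : K :=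
  q ^ (n + 2 * nStat lam) *
    ∏ i ∈ lam.parts.toFinset, ∏ k ∈ Finset.range (lam.parts.count i), (1 - q⁻¹ ^ (k + 1))

/-- `𝓗_λ(q) = 1 / a_λ(q)` -/
def HsH {n : ℕ} (lam : n.Partition) : K := (aP lam)⁻¹

/-- the Hall–Littlewood deformed `z`-factor of a power-sum monomial:
`z_λ(t) = z_λ Π_i (1 - t^{λ_i})⁻¹` with `t = q` -/
def zMonT (d : ℕ →₀ ℕ) : K := zMon d * ∏ i ∈ d.support, ((1 - q ^ (i + 1))⁻¹) ^ d i

/-- the `t = q` deformed Hall pairing `⟨p_λ, p_μ⟩_q = δ_{λμ} z_λ Π_i (1-q^{λ_i})⁻¹` -/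
def hallT (f g : SymF) : K := ∑ d ∈ f.support, coeff d f * coeff d g * zMonT d

/-- `h_λ = h_{λ_1} h_{λ_2} ⋯` (the basis dual to the monomial basis: the coefficient of
`m_μ` in a symmetric function `f` is `⟨f, h_μ⟩`) -/
def hProd {n : ℕ} (lam : n.Partition) : SymF := (lam.parts.map fun i => hP i).prod

/-- dominance order on partitions -/
def dominates {n : ℕ} (μ lam : n.Partition) : Prop :=
  ∀ k, ((sortedParts μ).take k).sum ≤ ((sortedParts lam).take k).sum

/-- the defining properties of the Hall–Littlewood symmetric functions `P_λ(x; q)`: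
degree `n` homogeneity, unitriangularity `P_λ = m_λ + Σ_{μ < λ} c_{λμ} m_μ` with respect to
dominance order, and orthogonality for the `t = q` deformed Hall pairing. -/
structure IsHLBasis (n : ℕ) (P : n.Partition → SymF) : Prop where
  homog : ∀ lam, (P lam).IsWeightedHomogeneous (fun i => i + 1) n
  triangular : ∀ lam μ, hall (P lam) (hProd μ) ≠ 0 → dominates μ lam
  diag : ∀ lam, hall (P lam) (hProd lam) = 1
  orth : ∀ lam μ, lam ≠ μ → hallT (P lam) (P μ) = 0

/-- the modified Kostka–Foulkes polynomials `K̃_{μλ}(q) = q^{n(λ)} K_{μλ}(q⁻¹)`, given the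
Kostka–Foulkes coefficients `Kst` (defined by `s_μ = Σ_λ K_{μλ}(q) P_λ(x;q)`) and the
automorphism `invq : q ↦ q⁻¹` of `ℚ(q)` -/
def Ktilde {n : ℕ} (Kst : n.Partition → n.Partition → K) (invq : K →+* K)
    (μ lam : n.Partition) : K :=
  q ^ nStat lam * invq (Kst μ lam)

/-- `y_ρ(q) = q^{-|ρ|} z_ρ Π_i (1 - q^{-ρ_i})⁻¹` -/
def yP {n : ℕ} (ρ : n.Partition) : K :=
  q⁻¹ ^ n * (zP ρ : K) * (ρ.parts.map fun i => ((1 : K) - q⁻¹ ^ i)⁻¹).prod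

/-!
STATEMENT 8: Orthogonality relations for Green polynomials:
`Σ_λ 𝓗_λ(q) Q^λ_ρ(q) Q^λ_σ(q) = δ_{ρσ} y_ρ(q)`, where
`Q^λ_ρ(q) = Σ_μ χ^μ_ρ K̃_{μλ}(q)`, `𝓗_λ(q) = 1/a_λ(q)` with `a_λ(q)` the centralizer order of
a unipotent of type `λ` in `GL_n(F_q)`, and `y_ρ(q) = q^{-n} z_ρ Π_i (1 - q^{-ρ_i})⁻¹`.
The modified Kostka–Foulkes polynomials `K̃_{μλ}(q) = q^{n(λ)} K_{μλ}(q⁻¹)` enter through the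
Kostka–Foulkes coefficients `K_{μλ}`, defined by `s_μ = Σ_λ K_{μλ}(q) P_λ(x;q)` with `P` the
Hall–Littlewood basis (characterized by `IsHLBasis`).
-/

/-- the Green polynomial `Q^λ_ρ(q) = Σ_μ χ^μ_ρ K̃_{μλ}(q)` -/
def greenQ {n : ℕ} (Kst : n.Partition → n.Partition → K) (invq : K →+* K)
    (lam ρ : n.Partition) : K :=
  ∑ μ : n.Partition, chiS μ ρ * Ktilde Kst invq μ lam

/-- the weight of the power-sum monomials, `p_{i+1}` having weight `i + 1` -/
def wtZ : ℕ → ℤ := fun i => (i : ℤ) + 1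

/-- the deformed `z`-factor of a power-sum monomial, for an arbitrary parameter `t` -/
def zDef (t : K) (d : ℕ →₀ ℕ) : K := zMon d * ∏ i ∈ d.support, ((1 - t ^ (i + 1))⁻¹) ^ d i

theorem zDef_eq_prod (t : K) (d : ℕ →₀ ℕ) {s : Finset ℕ} (hs : d.support ⊆ s) :
    zDef t d = ∏ i ∈ s, (((i + 1 : ℕ) : K) ^ d i * ((d i).factorial : K) *
      ((1 - t ^ (i + 1))⁻¹) ^ d i) := by
  rw [zDef, zMon, ← Finset.prod_mul_distrib]
  rw [Finset.prod_subset hs]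
  · exact Finset.prod_congr rfl fun i _ => by push_cast; ring
  · intro i _ hi
    simp [Finsupp.notMem_support_iff.1 hi]

theorem zDef_zero (t : K) : zDef t 0 = 1 := by simp [zDef, zMon]

theorem zDef_zero_left (d : ℕ →₀ ℕ) : zDef 0 d = zMon d := by simp [zDef]

theorem zDef_add_single (t : K) (d : ℕ →₀ ℕ) (i : ℕ) :
    zDef t (d + Finsupp.single i 1) =
      zDef t d * (((i : K) + 1) * ((d i : K) + 1) * (1 - t ^ (i + 1))⁻¹) := by
  have h1 : d.support ⊆ insert i d.support := Finset.subset_insert _ _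
  have h2 : (d + Finsupp.single i 1).support ⊆ insert i d.support := by
    intro j hj
    by_cases h : j = i
    · simp [h]
    · simp only [Finsupp.mem_support_iff, Finsupp.add_apply, Finsupp.single_apply,
        Ne.symm h, if_false, add_zero] at hj
      simp [hj]
  rw [zDef_eq_prod t d h1, zDef_eq_prod t _ h2]
  have hi : i ∈ insert i d.support := Finset.mem_insert_self _ _
  rw [← Finset.mul_prod_erase _ _ hi, ← Finset.mul_prod_erase _ _ hi]
  rw [Finset.prod_congr rfl (g := fun j => (((j + 1 : ℕ) : K) ^ d j * ((d j).factorial : K) *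
      ((1 - t ^ (j + 1))⁻¹) ^ d j))]
  · simp only [Finsupp.add_apply, Finsupp.single_eq_same, Nat.factorial_succ, pow_succ]
    push_cast
    ring
  · intro j hj
    have : i ≠ j := (Finset.ne_of_mem_erase hj).symm
    simp [this]

theorem zDef_ne_zero {t : K} (ht : ∀ k : ℕ, 1 - t ^ (k + 1) ≠ 0) (d : ℕ →₀ ℕ) :
    zDef t d ≠ 0 := by
  rw [zDef_eq_prod t d subset_rfl, Finset.prod_ne_zero_iff]
  intro i _
  have := Nat.cast_ne_zero (R := K).2 (Nat.factorial_ne_zero (d i))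
  have h : ((i + 1 : ℕ) : K) ≠ 0 := Nat.cast_ne_zero.2 i.succ_ne_zero
  exact mul_ne_zero (mul_ne_zero (pow_ne_zero _ h) this) (pow_ne_zero _ (inv_ne_zero (ht i)))

/-- the exponent vector of `p_ρ` as a monomial in the power sums -/
def expo {n : ℕ} (ρ : n.Partition) : ℕ →₀ ℕ := Multiset.toFinsupp (ρ.parts.map (· - 1))

theorem expo_injective {n : ℕ} : Function.Injective (expo (n := n)) := by
  intro ρ σ h
  have h' := Multiset.toFinsupp.injective h
  have key : ∀ τ : n.Partition, (τ.parts.map (· - 1)).map (· + 1) = τ.parts := by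
    intro τ
    rw [Multiset.map_map]
    conv_rhs => rw [← Multiset.map_id τ.parts]
    refine Multiset.map_congr rfl fun x hx => ?_
    have := τ.parts_pos hx
    simp only [Function.comp_apply, id_eq]
    omega
  ext1
  rw [← key ρ, ← key σ, h']

theorem weight_toFinsupp (s : Multiset ℕ) :
    Finsupp.weight wtZ (Multiset.toFinsupp s) = ((s.map (· + 1)).sum : ℕ) := by
  induction s using Multiset.induction_on with
  | empty => simp
  | cons a s ih =>
    rw [← Multiset.singleton_add, map_add, map_add, ih]
    simp [Multiset.toFinsupp_singleton, Finsupp.weight_single, wtZ]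

theorem weight_expo {n : ℕ} (ρ : n.Partition) : Finsupp.weight wtZ (expo ρ) = n := by
  rw [expo, weight_toFinsupp, Multiset.map_map]
  conv_rhs => rw [← ρ.parts_sum, ← Multiset.map_id ρ.parts]
  rw [Multiset.map_congr rfl]
  intro x hx
  have := ρ.parts_pos hx
  simp only [Function.comp_apply, id_eq]
  omega

theorem exists_expo_eq {n : ℕ} {d : ℕ →₀ ℕ} (hd : Finsupp.weight wtZ d = n) :
    ∃ ρ : n.Partition, expo ρ = d := by
  have hsum : ((Finsupp.toMultiset d).map (· + 1)).sum = n := by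
    have := weight_toFinsupp (Finsupp.toMultiset d)
    rw [Finsupp.toMultiset_toFinsupp, hd] at this
    exact_mod_cast this.symm
  refine ⟨⟨(Finsupp.toMultiset d).map (· + 1), ?_, hsum⟩, ?_⟩
  · intro i hi
    obtain ⟨j, _, rfl⟩ := Multiset.mem_map.1 hi
    exact j.succ_pos
  · simp [expo, Multiset.map_map]

theorem pP_eq_monomial {n : ℕ} (ρ : n.Partition) : pP ρ = monomial (expo ρ) 1 := by
  have key : ∀ s : Multiset ℕ, (s.map fun i => (X i : SymF)).prod =
      monomial (Multiset.toFinsupp s) 1 := by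
    intro s
    induction s using Multiset.induction_on with
    | empty => simp
    | cons a s ih =>
      rw [Multiset.map_cons, Multiset.prod_cons, ih, ← Multiset.singleton_add, map_add,
        Multiset.toFinsupp_singleton, X, monomial_mul, mul_one]
  rw [pP, expo, ← key, Multiset.map_map]
  rfl

theorem expo_apply {n : ℕ} (ρ : n.Partition) (i : ℕ) : expo ρ i = ρ.parts.count (i + 1) := by
  rw [expo, Multiset.toFinsupp_apply, Multiset.count_map, Multiset.count_eq_card_filter_eq]
  congr 1
  refine Multiset.filter_congr fun x hx => ?_
  have := ρ.parts_pos hx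
  omega

theorem prod_toFinset_parts {M : Type*} [CommMonoid M] {n : ℕ} (ρ : n.Partition) (f : ℕ → M) :
    ∏ i ∈ ρ.parts.toFinset, f i = ∏ i ∈ (expo ρ).support, f (i + 1) := by
  symm
  refine Finset.prod_bij (fun i _ => i + 1) ?_ ?_ ?_ ?_
  · intro i hi
    rw [Finsupp.mem_support_iff, expo_apply] at hi
    exact Multiset.mem_toFinset.2 (Multiset.count_ne_zero.1 hi)
  · intro i _ j _ h
    exact Nat.succ.inj h
  · intro i hi
    have hi' := Multiset.mem_toFinset.1 hi
    have := ρ.parts_pos hi'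
    have h1 : i - 1 + 1 = i := by omega
    refine ⟨i - 1, ?_, h1⟩
    rw [Finsupp.mem_support_iff, expo_apply, h1]
    exact Multiset.count_ne_zero.2 hi'
  · intro i _
    rfl

theorem zMon_expo {n : ℕ} (ρ : n.Partition) : zMon (expo ρ) = (zP ρ : K) := by
  rw [zP, prod_toFinset_parts, zMon]
  push_cast
  exact Finset.prod_congr rfl fun i _ => by rw [expo_apply]

/-- the bilinear form with `⟨p_λ, p_μ⟩ = δ_{λμ} z_λ Π_i (1 - t^{λ_i})⁻¹` -/
def pairing (t : K) : SymF →ₗ[K] SymF →ₗ[K] K :=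
  (basisMonomials ℕ K).constr K fun d => zDef t d • lcoeff K d

theorem pairing_monomial_left (t : K) (d : ℕ →₀ ℕ) (a : K) (g : SymF) :
    pairing t (monomial d a) g = a * coeff d g * zDef t d := by
  have h1 : monomial d a = a • (basisMonomials ℕ K) d := by simp [smul_monomial]
  rw [h1, map_smul, pairing, Module.Basis.constr_basis]
  simp [lcoeff]
  ring

theorem pairing_eq_sum (t : K) (f g : SymF) :
    pairing t f g = ∑ d ∈ f.support, coeff d f * coeff d g * zDef t d := by
  conv_lhs => rw [f.as_sum, map_sum, LinearMap.sum_apply]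
  exact Finset.sum_congr rfl fun d _ => pairing_monomial_left t d _ g

theorem hallT_eq (f g : SymF) : hallT f g = pairing q f g := by
  rw [pairing_eq_sum]
  rfl

theorem hall_eq (f g : SymF) : hall f g = pairing 0 f g := by
  simp only [pairing_eq_sum, zDef_zero_left]
  rfl

theorem pairing_comm (t : K) (f g : SymF) : pairing t f g = pairing t g f := by
  rw [pairing_eq_sum, pairing_eq_sum,
    Finset.sum_subset (Finset.subset_union_left (s₂ := g.support)),
    Finset.sum_subset (Finset.subset_union_right (s₁ := f.support) (s₂ := g.support))]
  · exact Finset.sum_congr rfl fun d _ => by ring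
  · intro d _ hd
    simp [notMem_support_iff.1 hd]
  · intro d _ hd
    simp [notMem_support_iff.1 hd]

theorem pairing_one_left (t : K) (g : SymF) : pairing t 1 g = coeff 0 g := by
  have := pairing_monomial_left t 0 1 g
  rw [zDef_zero] at this
  simpa using this

theorem pairing_X_mul {t : K} (ht : ∀ k : ℕ, 1 - t ^ (k + 1) ≠ 0) (i : ℕ) (f g : SymF) :
    (1 - t ^ (i + 1)) * pairing t (X i * f) g = ((i : K) + 1) * pairing t f (pderiv i g) := by
  induction f using MvPolynomial.induction_on' with
  | monomial d a =>
    rw [X, monomial_mul, pairing_monomial_left, pairing_monomial_left, coeff_pderiv,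
      add_comm (Finsupp.single i 1) d, zDef_add_single]
    have := ht i
    field_simp
  | add f₁ f₂ h1 h2 =>
    simp only [mul_add, map_add, LinearMap.add_apply, h1, h2]

theorem eq_zero_of_pairing {t : K} (ht : ∀ k : ℕ, 1 - t ^ (k + 1) ≠ 0) {f : SymF}
    (h : ∀ g, pairing t g f = 0) : f = 0 := by
  ext d
  have := h (monomial d 1)
  rw [pairing_monomial_left] at this
  simpa [zDef_ne_zero ht d] using this

theorem pairing_eq_zero_of_weight_ne (t : K) {f g : SymF} {m n : ℤ}
    (hf : f.IsWeightedHomogeneous wtZ m) (hg : g.IsWeightedHomogeneous wtZ n) (hmn : m ≠ n) :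
    pairing t f g = 0 := by
  rw [pairing_eq_sum]
  refine Finset.sum_eq_zero fun d hd => ?_
  have h1 := hf (mem_support_iff.1 hd)
  rw [hg.coeff_eq_zero d (by rw [h1]; exact hmn)]
  ring

theorem pairing_eq_sum_partition (t : K) {n : ℕ} {f : SymF}
    (hf : f.IsWeightedHomogeneous wtZ n) (g : SymF) :
    pairing t f g = ∑ ρ : n.Partition, coeff (expo ρ) f * coeff (expo ρ) g * zDef t (expo ρ) := by
  have himg : f.support ⊆ Finset.univ.image (expo (n := n)) := by
    intro d hd
    obtain ⟨ρ, rfl⟩ := exists_expo_eq (hf (mem_support_iff.1 hd))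
    exact Finset.mem_image_of_mem _ (Finset.mem_univ ρ)
  rw [pairing_eq_sum, Finset.sum_subset himg, Finset.sum_image (expo_injective.injOn)]
  intro d _ hd
  simp [notMem_support_iff.1 hd]

/-- `q_m(t) = Σ_{ρ ⊢ m} z_ρ(t)⁻¹ p_ρ` for `m : ℤ`, vanishing for `m < 0` -/
def qInt (t : K) (m : ℤ) : SymF :=
  if m < 0 then 0 else ∑ ρ : m.toNat.Partition, (zDef t (expo ρ))⁻¹ • pP ρ

theorem qInt_zero_left (m : ℤ) : qInt 0 m = hZ m := by
  simp only [qInt, hZ, hP, zDef_zero_left, zMon_expo]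

theorem weight_nonneg (d : ℕ →₀ ℕ) : 0 ≤ Finsupp.weight wtZ d := by
  rw [Finsupp.weight_apply]
  refine Finset.sum_nonneg fun i _ => ?_
  simp only [wtZ]
  positivity

theorem coeff_qInt (t : K) (m : ℤ) (d : ℕ →₀ ℕ) :
    coeff d (qInt t m) = if Finsupp.weight wtZ d = m then (zDef t d)⁻¹ else 0 := by
  rw [qInt]
  split_ifs with h1 h2 h2
  · have := weight_nonneg d
    omega
  · simp
  · have hm : ((m.toNat : ℕ) : ℤ) = m := Int.toNat_of_nonneg (not_lt.1 h1)
    obtain ⟨ρ, rfl⟩ := exists_expo_eq (n := m.toNat) (h2.trans hm.symm)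
    rw [coeff_sum, Finset.sum_eq_single ρ]
    · simp [pP_eq_monomial]
    · intro σ _ hσ
      have : expo σ ≠ expo ρ := fun h => hσ (expo_injective h)
      simp [pP_eq_monomial, coeff_monomial, this]
    · simp
  · rw [coeff_sum]
    refine Finset.sum_eq_zero fun σ _ => ?_
    have : expo σ ≠ d := by
      rintro rfl
      apply h2
      rw [weight_expo]
      exact Int.toNat_of_nonneg (not_lt.1 h1)
    simp [pP_eq_monomial, coeff_monomial, this]

theorem qInt_of_neg (t : K) {m : ℤ} (h : m < 0) : qInt t m = 0 := by simp [qInt, h]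

theorem qInt_zero (t : K) : qInt t 0 = 1 := by
  ext d
  rw [coeff_qInt, coeff_one]
  by_cases hd : 0 = d
  · subst hd
    simp [zDef_zero]
  · rw [if_neg hd, if_neg]
    intro h
    obtain ⟨ρ, h1⟩ := exists_expo_eq (n := 0) h
    apply hd
    rw [← h1]
    ext i
    simp [expo_apply]

theorem qInt_isWeightedHomogeneous (t : K) (m : ℤ) :
    (qInt t m).IsWeightedHomogeneous wtZ m := by
  intro d hd
  by_contra h
  rw [coeff_qInt, if_neg h] at hd
  exact hd rfl

theorem pderiv_qInt {t : K} (ht : ∀ k : ℕ, 1 - t ^ (k + 1) ≠ 0) (m : ℤ) (i : ℕ) :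
    ((i : K) + 1) • pderiv i (qInt t m) = (1 - t ^ (i + 1)) • qInt t (m - (i + 1)) := by
  ext d
  rw [coeff_smul, coeff_smul, coeff_pderiv, coeff_qInt, coeff_qInt, map_add,
    Finsupp.weight_single, zDef_add_single]
  have h1 := ht i
  have h2 := zDef_ne_zero ht d
  have h3 : (i : K) + 1 ≠ 0 := Nat.cast_add_one_ne_zero i
  have h4 : (d i : K) + 1 ≠ 0 := Nat.cast_add_one_ne_zero (d i)
  by_cases h : Finsupp.weight wtZ d = m - (i + 1)
  · rw [if_pos h, if_pos (by rw [h]; simp [wtZ])]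
    simp only [smul_eq_mul]
    field_simp
  · rw [if_neg h, if_neg]
    · simp
    · intro h'
      apply h
      simp [wtZ] at h'
      linarith

/-- Newton's identity for the `q_m(t)` -/
theorem smul_qInt_eq_sum {t : K} (ht : ∀ k : ℕ, 1 - t ^ (k + 1) ≠ 0) (r : ℕ) :
    (r : K) • qInt t r =
      ∑ i ∈ Finset.range r, (1 - t ^ (i + 1)) • (X i * qInt t (r - (i + 1))) := by
  have h1 : ∀ i : ℕ, (1 - t ^ (i + 1)) • (X i * qInt t (r - (i + 1))) =
      ((i : K) + 1) • (X i * pderiv i (qInt t r)) := by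
    intro i
    rw [← mul_smul_comm, ← pderiv_qInt ht, mul_smul_comm]
  simp only [h1]
  ext d
  have h2 : ∀ (i : ℕ) (f : SymF), coeff d (X i * pderiv i f) = d i * coeff d f := by
    intro i f
    rw [mul_comm, coeff_mul_X']
    split_ifs with h
    · have h' : 1 ≤ d i := Nat.one_le_iff_ne_zero.2 (Finsupp.mem_support_iff.1 h)
      have h3 : d - Finsupp.single i 1 + Finsupp.single i 1 = d :=
        tsub_add_cancel_of_le (by simpa using h')
      rw [coeff_pderiv, h3]
      simp only [Finsupp.tsub_apply, Finsupp.single_eq_same]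
      push_cast [h']
      ring
    · simp [Finsupp.notMem_support_iff.1 h]
  rw [coeff_smul, coeff_sum]
  simp only [coeff_smul, h2, smul_eq_mul]
  by_cases hd : Finsupp.weight wtZ d = r
  · rw [← Finset.sum_congr rfl (fun i _ => mul_assoc _ _ _), ← Finset.sum_mul]
    congr 1
    have h3 : d.support ⊆ Finset.range r := by
      obtain ⟨ρ, rfl⟩ := exists_expo_eq hd
      intro i hi
      rw [Finsupp.mem_support_iff, expo_apply] at hi
      have := Nat.Partition.le_of_mem_parts (Multiset.count_ne_zero.1 hi)
      exact Finset.mem_range.2 (by omega)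
    rw [Finsupp.weight_apply, Finsupp.sum_of_support_subset _ h3 _ (by simp)] at hd
    have h4 := congrArg (Int.cast : ℤ → K) hd
    simp only [wtZ] at h4
    push_cast at h4
    rw [← h4]
    exact Finset.sum_congr rfl fun i _ => by simp; ring
  · simp [coeff_qInt, hd]

/-- the translation `p_k ↦ p_k + ε v^k`: for `ε = 1` it adjoins a variable `v` to the alphabet,
for `ε = -1` it removes one -/
def shift (ε : K) : SymF →+* Polynomial SymF :=
  eval₂Hom (Polynomial.C.comp MvPolynomial.C)
    fun i => Polynomial.C (X i) + Polynomial.C (C ε) * Polynomial.X ^ (i + 1)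

theorem shift_C (ε a : K) : shift ε (C a) = Polynomial.C (C a) := by simp [shift]

theorem shift_X (ε : K) (i : ℕ) : shift ε (X i) =
    Polynomial.C (X i) + Polynomial.C (C ε) * Polynomial.X ^ (i + 1) := by simp [shift]

theorem shift_smul (ε a : K) (f : SymF) : shift ε (a • f) = Polynomial.C (C a) * shift ε f := by
  rw [MvPolynomial.smul_eq_C_mul, map_mul, shift_C]

/-- the coefficient of `v^k` in the translate of `f` -/
def shiftCoeff (ε : K) (k : ℕ) : SymF →ₗ[K] SymF where
  toFun f := (shift ε f).coeff k
  map_add' f g := by simp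
  map_smul' a f := by
    rw [shift_smul, Polynomial.coeff_C_mul, MvPolynomial.smul_eq_C_mul, RingHom.id_apply]

theorem shiftCoeff_apply (ε : K) (k : ℕ) (f : SymF) :
    shiftCoeff ε k f = (shift ε f).coeff k := rfl

theorem shiftCoeff_zero (ε : K) (f : SymF) : shiftCoeff ε 0 f = f := by
  have h : (Polynomial.constantCoeff.comp (shift ε) : SymF →+* SymF) = RingHom.id _ := by
    apply MvPolynomial.ringHom_ext
    · intro r
      simp [shift_C]
    · intro i
      simp [shift_X]
  exact congrArg (fun φ : SymF →+* SymF => φ f) h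

theorem X_pow_dvd_shift_derivative (ε : K) (N : ℕ) (f : SymF) :
    (Polynomial.X : Polynomial SymF) ^ (N + 1) ∣
      Polynomial.X * Polynomial.derivative (shift ε f) -
        ∑ i ∈ Finset.range N, Polynomial.C (C (ε * (i + 1))) * Polynomial.X ^ (i + 1) *
          shift ε (pderiv i f) := by
  induction f using MvPolynomial.induction_on with
  | C a => simp [shift_C]
  | add f g hf hg =>
    convert dvd_add hf hg using 1
    simp only [map_add, mul_add, Finset.sum_add_distrib]
    ring
  | mul_X f n hf =>
    have hX : (Polynomial.X : Polynomial SymF) ^ (N + 1) ∣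
      Polynomial.X * Polynomial.derivative (shift ε (X n)) -
        ∑ i ∈ Finset.range N, Polynomial.C (C (ε * (i + 1))) * Polynomial.X ^ (i + 1) *
          shift ε (pderiv i (X n)) := by
      have h1 : Polynomial.X * Polynomial.derivative (shift ε (X n)) =
          Polynomial.C (C (ε * (n + 1))) * Polynomial.X ^ (n + 1) := by
        rw [shift_X]
        simp
        ring
      have h2 : ∀ i : ℕ, Polynomial.C (C (ε * (i + 1))) * Polynomial.X ^ (i + 1) *
          shift ε (pderiv i (X n)) = if n = i then
            Polynomial.C (C (ε * (n + 1))) * Polynomial.X ^ (n + 1) else 0 := by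
        intro i
        rw [pderiv_X]
        split_ifs with h
        · subst h
          simp
        · simp [h]
      simp only [h1, h2, Finset.sum_ite_eq, Finset.mem_range]
      split_ifs with h
      · simp
      · rw [sub_zero]
        exact Dvd.dvd.mul_left (pow_dvd_pow _ (by omega)) _
    convert dvd_add (hf.mul_right (shift ε (X n))) (hX.mul_left (shift ε f)) using 1
    have hsum : ∀ c : ℕ → Polynomial SymF,
        ∑ i ∈ Finset.range N, c i * shift ε (pderiv i (f * X n)) =
          (∑ i ∈ Finset.range N, c i * shift ε (pderiv i f)) * shift ε (X n) +
            shift ε f * ∑ i ∈ Finset.range N, c i * shift ε (pderiv i (X n)) := by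
      intro c
      rw [Finset.sum_mul, Finset.mul_sum, ← Finset.sum_add_distrib]
      refine Finset.sum_congr rfl fun i _ => ?_
      rw [Derivation.leibniz, smul_eq_mul, smul_eq_mul, map_add, map_mul, map_mul]
      ring
    rw [hsum, map_mul, Polynomial.derivative_mul]
    ring

theorem smul_shiftCoeff_eq_sum (ε : K) (k : ℕ) (f : SymF) :
    (k : K) • shiftCoeff ε k f =
      ∑ i ∈ Finset.range k, (ε * (i + 1)) • shiftCoeff ε (k - (i + 1)) (pderiv i f) := by
  have h := (Polynomial.X_pow_dvd_iff.1 (X_pow_dvd_shift_derivative ε k f)) k (by omega)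
  rw [Polynomial.coeff_sub, sub_eq_zero, Polynomial.finsetSum_coeff] at h
  have h1 : (Polynomial.X * Polynomial.derivative (shift ε f)).coeff k =
      (k : K) • shiftCoeff ε k f := by
    cases k with
    | zero => simp
    | succ k =>
      rw [Polynomial.coeff_X_mul, Polynomial.coeff_derivative, shiftCoeff_apply,
        MvPolynomial.smul_eq_C_mul]
      simp
      ring
  rw [← h1, h]
  refine Finset.sum_congr rfl fun i hi => ?_
  have hi' := Finset.mem_range.1 hi
  rw [mul_assoc, Polynomial.coeff_C_mul, Polynomial.coeff_X_pow_mul', if_pos (by omega),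
    MvPolynomial.smul_eq_C_mul, shiftCoeff_apply]

theorem shiftCoeff_mul (ε : K) (k : ℕ) (f g : SymF) :
    shiftCoeff ε k (f * g) =
      ∑ j ∈ Finset.range (k + 1), shiftCoeff ε j f * shiftCoeff ε (k - j) g := by
  rw [shiftCoeff_apply, map_mul, Polynomial.coeff_mul,
    Finset.Nat.sum_antidiagonal_eq_sum_range_succ_mk]
  rfl

theorem natCast_succ_smul_cancel {k : ℕ} {f g : SymF}
    (h : ((k + 1 : ℕ) : K) • f = ((k + 1 : ℕ) : K) • g) : f = g :=
  (smul_right_injective SymF (Nat.cast_ne_zero (R := K).2 k.succ_ne_zero)) h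

/-- adjoining a variable to `q_m(t)` -/
theorem shiftCoeff_one_qInt {t : K} (ht : ∀ k : ℕ, 1 - t ^ (k + 1) ≠ 0) (k : ℕ) (m : ℤ) :
    shiftCoeff 1 (k + 1) (qInt t m) = (1 - t) • qInt t (m - (k + 1)) := by
  induction k using Nat.strong_induction_on generalizing m with
  | _ k ih =>
    apply natCast_succ_smul_cancel (k := k)
    rw [smul_shiftCoeff_eq_sum, Finset.sum_range_succ]
    have h1 : ∀ i : ℕ, ((1 : K) * (i + 1)) • shiftCoeff 1 (k + 1 - (i + 1)) (pderiv i (qInt t m)) =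
        (1 - t ^ (i + 1)) • shiftCoeff 1 (k - i) (qInt t (m - (i + 1))) := by
      intro i
      rw [one_mul, ← map_smul, pderiv_qInt ht, map_smul, Nat.add_sub_add_right]
    simp only [h1]
    have h2 : ∀ i ∈ Finset.range k, (1 - t ^ (i + 1)) • shiftCoeff 1 (k - i)
        (qInt t (m - (i + 1))) = ((1 - t) * (1 - t ^ (i + 1))) • qInt t (m - (k + 1)) := by
      intro i hi
      have hi' := Finset.mem_range.1 hi
      obtain ⟨j, rfl⟩ : ∃ j, k = i + j + 1 := ⟨k - i - 1, by omega⟩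
      have : i + j + 1 - i = j + 1 := by omega
      rw [this, ih j (by omega), smul_smul, mul_comm]
      congr 2
      push_cast
      ring
    rw [Finset.sum_congr rfl h2, ← Finset.sum_smul, Nat.sub_self, shiftCoeff_zero, ← add_smul,
      smul_smul]
    congr 1
    clear ih h1 h2
    induction k with
    | zero => simp
    | succ k ih =>
      rw [Finset.sum_range_succ]
      push_cast at ih ⊢
      linear_combination ih

theorem shiftCoeff_one_qInt' {t : K} (ht : ∀ k : ℕ, 1 - t ^ (k + 1) ≠ 0) (k : ℕ) (m : ℤ) :
    shiftCoeff 1 k (qInt t m) = (if k = 0 then 1 else 1 - t) • qInt t (m - k) := by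
  cases k with
  | zero => simp [shiftCoeff_zero]
  | succ k =>
    rw [shiftCoeff_one_qInt ht]
    simp

/-- multiplication by `q_r(t)` is adjoint to taking the coefficient of `v^r` after adjoining
a variable `v` -/
theorem pairing_qInt_mul {t : K} (ht : ∀ k : ℕ, 1 - t ^ (k + 1) ≠ 0) (r : ℕ) (f g : SymF) :
    pairing t (qInt t r * f) g = pairing t f (shiftCoeff 1 r g) := by
  induction r using Nat.strong_induction_on generalizing f g with
  | _ r ih =>
    rcases r with _ | r
    · simp [qInt_zero, shiftCoeff_zero]
    · have hr : ((r + 1 : ℕ) : K) ≠ 0 := Nat.cast_ne_zero.2 r.succ_ne_zero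
      apply mul_left_cancel₀ hr
      have hl : ((r + 1 : ℕ) : K) * pairing t (qInt t ((r + 1 : ℕ) : ℤ) * f) g =
          pairing t ((((r + 1 : ℕ) : K) • qInt t ((r + 1 : ℕ) : ℤ)) * f) g := by
        rw [smul_mul_assoc, map_smul, LinearMap.smul_apply, smul_eq_mul]
      have hr' : ((r + 1 : ℕ) : K) * pairing t f (shiftCoeff 1 (r + 1) g) =
          pairing t f (((r + 1 : ℕ) : K) • shiftCoeff 1 (r + 1) g) := by
        rw [map_smul, smul_eq_mul]
      rw [hl, hr', smul_shiftCoeff_eq_sum, smul_qInt_eq_sum ht, Finset.sum_mul, map_sum,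
        map_sum, LinearMap.sum_apply]
      refine Finset.sum_congr rfl fun i hi => ?_
      have hi' := Finset.mem_range.1 hi
      have e : ((r + 1 : ℕ) : ℤ) - (i + 1) = ((r + 1 - (i + 1) : ℕ) : ℤ) := by omega
      rw [smul_mul_assoc, mul_assoc, map_smul, LinearMap.smul_apply, smul_eq_mul,
        pairing_X_mul ht, e, ih _ (by omega), map_smul, one_mul, smul_eq_mul]

theorem shiftCoeff_isWeightedHomogeneous (ε : K) (k : ℕ) {f : SymF} {n : ℤ}
    (hf : f.IsWeightedHomogeneous wtZ n) :
    (shiftCoeff ε k f).IsWeightedHomogeneous wtZ (n - k) := by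
  induction k using Nat.strong_induction_on generalizing f n with
  | _ k ih =>
    rcases k with _ | k
    · simpa [shiftCoeff_zero] using hf
    · have h : ((k + 1 : ℕ) : K) • shiftCoeff ε (k + 1) f ∈
          weightedHomogeneousSubmodule K wtZ (n - (k + 1 : ℕ)) := by
        rw [smul_shiftCoeff_eq_sum]
        refine Submodule.sum_mem _ fun i hi => Submodule.smul_mem _ _ ?_
        have hi' := Finset.mem_range.1 hi
        have h1 := ih (k + 1 - (i + 1)) (by omega)
          (hf.pderiv (i := i) (n' := n - (i + 1)) (by simp [wtZ]))
        have e : n - (i + 1) - ((k + 1 - (i + 1) : ℕ) : ℤ) = n - (k + 1 : ℕ) := by omega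
        rw [e] at h1
        exact h1
      have hk : ((k + 1 : ℕ) : K) ≠ 0 := Nat.cast_ne_zero.2 k.succ_ne_zero
      exact (Submodule.smul_mem_iff _ hk).1 h

theorem shiftCoeff_comm (a b : K) (j k : ℕ) (f : SymF) :
    shiftCoeff a k (shiftCoeff b j f) = shiftCoeff b j (shiftCoeff a k f) := by
  have hcoeff : ∀ (p : Polynomial (Polynomial SymF)) (i j : ℕ),
      ((Polynomial.Bivariate.swap p).coeff i).coeff j = (p.coeff j).coeff i := by
    intro p i j
    induction p using Polynomial.induction_on' with
    | add p q hp hq => simp [hp, hq]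
    | monomial n p =>
      induction p using Polynomial.induction_on' with
      | add p q hp hq =>
        simp only [map_add, Polynomial.coeff_add, hp, hq]
      | monomial m r =>
        rw [Polynomial.Bivariate.swap_monomial_monomial]
        simp only [Polynomial.coeff_monomial]
        split_ifs <;> simp_all [Polynomial.coeff_monomial]
  have h : ((Polynomial.mapRingHom (shift a)).comp (shift b) : SymF →+* _) =
      ((Polynomial.Bivariate.swap (R := SymF)).toRingEquiv.toRingHom).comp
        ((Polynomial.mapRingHom (shift b)).comp (shift a)) := by
    apply MvPolynomial.ringHom_ext
    · intro r
      simp [shift_C, Polynomial.Bivariate.swap_C_C]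
    · intro i
      simp [shift_X, shift_C, Polynomial.Bivariate.swap_C_C, Polynomial.Bivariate.swap_X,
        Polynomial.Bivariate.swap_Y]
      ring
  have h' := congrArg (fun φ : SymF →+* Polynomial (Polynomial SymF) => ((φ f).coeff j).coeff k) h
  simpa [hcoeff, shiftCoeff_apply] using h'

/-- removing a variable after adjoining the same variable is the identity -/
theorem eval₂_shift (f : SymF) :
    Polynomial.eval₂ (shift (-1)) Polynomial.X (shift 1 f) = Polynomial.C f := by
  have h : (Polynomial.eval₂RingHom (shift (-1)) Polynomial.X).comp (shift 1) =
      (Polynomial.C : SymF →+* Polynomial SymF) := by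
    apply MvPolynomial.ringHom_ext
    · intro r
      simp [shift_C]
    · intro i
      simp [shift_X]
      ring
  exact congrArg (fun φ : SymF →+* Polynomial SymF => φ f) h

/-- the `SymF`-linear map sending `z^s` to `q_{m+s}(t)` -/
def qLin (t : K) (m : ℤ) : Polynomial SymF →ₗ[SymF] SymF :=
  (Polynomial.basisMonomials SymF).constr SymF fun s => qInt t (m + s)

theorem qLin_monomial (t : K) (m : ℤ) (s : ℕ) (a : SymF) :
    qLin t m (Polynomial.monomial s a) = a * qInt t (m + s) := by
  have h1 : Polynomial.monomial s a = a • (Polynomial.basisMonomials SymF) s := by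
    simp [Polynomial.smul_monomial]
  rw [h1, map_smul, qLin, Module.Basis.constr_basis, smul_eq_mul]

theorem qLin_C (t : K) (m : ℤ) (a : SymF) : qLin t m (Polynomial.C a) = a * qInt t m := by
  rw [← Polynomial.monomial_zero_left, qLin_monomial]
  simp

theorem qLin_mul_X_pow (t : K) (m : ℤ) (p : Polynomial SymF) (k : ℕ) :
    qLin t m (p * Polynomial.X ^ k) = qLin t (m + k) p := by
  induction p using Polynomial.induction_on' with
  | add p q hp hq => rw [add_mul, map_add, map_add, hp, hq]
  | monomial n a =>
    rw [Polynomial.monomial_mul_X_pow, qLin_monomial, qLin_monomial]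
    congr 2
    push_cast
    ring

theorem qLin_eq_sum (t : K) (m : ℤ) (p : Polynomial SymF) {N : ℕ} (hN : p.natDegree < N) :
    qLin t m p = ∑ s ∈ Finset.range N, p.coeff s * qInt t (m + s) := by
  conv_lhs => rw [p.as_sum_range' N hN, map_sum]
  exact Finset.sum_congr rfl fun s _ => qLin_monomial t m s _

/-- the creation operators of the Hall–Littlewood functions -/
def creation (t : K) (m : ℤ) : SymF →ₗ[K] SymF where
  toFun f := qLin t m (shift (-1) f)
  map_add' f g := by simp
  map_smul' a f := by
    rw [shift_smul, ← Polynomial.smul_eq_C_mul, map_smul, RingHom.id_apply, smul_eq_mul,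
      MvPolynomial.smul_eq_C_mul]

theorem creation_apply (t : K) (m : ℤ) (f : SymF) :
    creation t m f = qLin t m (shift (-1) f) := rfl

theorem creation_eq_sum (t : K) (m : ℤ) (f : SymF) {N : ℕ}
    (hN : (shift (-1) f).natDegree < N) :
    creation t m f = ∑ s ∈ Finset.range N, shiftCoeff (-1) s f * qInt t (m + s) :=
  qLin_eq_sum t m _ hN

theorem creation_isWeightedHomogeneous (t : K) (m : ℤ) {f : SymF} {n : ℤ}
    (hf : f.IsWeightedHomogeneous wtZ n) :
    (creation t m f).IsWeightedHomogeneous wtZ (m + n) := by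
  rw [creation_eq_sum t m f (Nat.lt_succ_self _)]
  refine Submodule.sum_mem (weightedHomogeneousSubmodule K wtZ (m + n)) fun s _ => ?_
  have h := (shiftCoeff_isWeightedHomogeneous (-1) s hf).mul
    (qInt_isWeightedHomogeneous t (m + s))
  rwa [show n - s + (m + s) = m + n by ring] at h

theorem sum_creation_shiftCoeff (t : K) (a : ℤ) (f : SymF) {N : ℕ}
    (hN : (shift 1 f).natDegree < N) :
    ∑ j ∈ Finset.range N, creation t (a + j) (shiftCoeff 1 j f) = f * qInt t a := by
  rw [← qLin_C, ← eval₂_shift, Polynomial.eval₂_eq_sum_range' _ hN, map_sum]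
  exact Finset.sum_congr rfl fun j _ => (qLin_mul_X_pow t a _ j).symm

theorem shiftCoeff_creation {t : K} (ht : ∀ k : ℕ, 1 - t ^ (k + 1) ≠ 0) (m : ℤ) (k : ℕ)
    (f : SymF) :
    shiftCoeff 1 k (creation t m f) = ∑ j ∈ Finset.range (k + 1),
      (if k - j = 0 then 1 else 1 - t) • creation t (m - k + j) (shiftCoeff 1 j f) := by
  obtain ⟨N, hN⟩ : ∃ N, ∀ j ∈ Finset.range (k + 1),
      (shift (-1) (shiftCoeff 1 j f)).natDegree < N :=
    ⟨(Finset.range (k + 1)).sup (fun j => (shift (-1) (shiftCoeff 1 j f)).natDegree) + 1,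
      fun j hj => Nat.lt_succ_of_le (Finset.le_sup
        (f := fun j => (shift (-1) (shiftCoeff 1 j f)).natDegree) hj)⟩
  have h0 := hN 0 (by simp)
  rw [shiftCoeff_zero] at h0
  rw [creation_eq_sum t m f h0, map_sum]
  simp only [shiftCoeff_mul]
  rw [Finset.sum_comm]
  refine Finset.sum_congr rfl fun j hj => ?_
  have hj' := Finset.mem_range.1 hj
  rw [creation_eq_sum _ _ _ (hN j hj), Finset.smul_sum]
  refine Finset.sum_congr rfl fun s _ => ?_
  rw [shiftCoeff_comm, shiftCoeff_one_qInt' ht, mul_smul_comm]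
  congr 3
  omega

theorem shiftCoeff_creation_of_natDegree_le {t : K} (ht : ∀ k : ℕ, 1 - t ^ (k + 1) ≠ 0) (m : ℤ)
    {k : ℕ} {f : SymF} (hf : (shift 1 f).natDegree ≤ k) :
    shiftCoeff 1 k (creation t m f) =
      t • creation t m (shiftCoeff 1 k f) + (1 - t) • (f * qInt t (m - k)) := by
  rw [← sum_creation_shiftCoeff t (m - k) f (Nat.lt_succ_of_le hf), shiftCoeff_creation ht,
    Finset.sum_range_succ, Finset.sum_range_succ, smul_add, Finset.smul_sum,
    Finset.sum_congr rfl (g := fun j : ℕ => (1 - t) •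
      creation t (m - k + j) (shiftCoeff 1 j f))]
  · rw [Nat.sub_self, if_pos rfl, sub_add_cancel]
    simp only [sub_smul, one_smul]
    abel
  · intro j hj
    have := Finset.mem_range.1 hj
    rw [if_neg (by omega)]

/-- removing a variable from `h_m` -/
theorem shift_neg_one_hZ (m : ℤ) :
    shift (-1) (hZ m) = Polynomial.C (hZ m) - Polynomial.X * Polynomial.C (hZ (m - 1)) := by
  have ht : ∀ k : ℕ, (1 : K) - 0 ^ (k + 1) ≠ 0 := by simp
  have key : ∀ (k : ℕ) (m : ℤ), shiftCoeff (-1) (k + 1) (qInt 0 m) =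
      if k = 0 then - qInt 0 (m - 1) else 0 := by
    intro k
    induction k using Nat.strong_induction_on with
    | _ k ih =>
      intro m
      have h1 : ∀ i : ℕ, ((-1 : K) * (i + 1)) •
          shiftCoeff (-1) (k + 1 - (i + 1)) (pderiv i (qInt 0 m)) =
            - shiftCoeff (-1) (k - i) (qInt 0 (m - (i + 1))) := by
        intro i
        rw [neg_one_mul, neg_smul, ← map_smul, pderiv_qInt ht, map_smul, Nat.add_sub_add_right]
        simp
      apply natCast_succ_smul_cancel (k := k)
      rw [smul_shiftCoeff_eq_sum, Finset.sum_congr rfl fun i _ => h1 i, Finset.sum_range_succ,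
        Nat.sub_self, shiftCoeff_zero]
      rcases k with _ | k
      · simp
      · rw [Finset.sum_range_succ, Finset.sum_eq_zero]
        · have h2 := ih 0 (by omega) (m - (k + 1))
          rw [zero_add] at h2
          rw [Nat.add_sub_cancel_left, h2]
          simp
          rw [show m - ((k : ℤ) + 1) - 1 = m - (k + 1 + 1) by ring]
          simp
        · intro i hi
          have hi' := Finset.mem_range.1 hi
          obtain ⟨j, rfl⟩ : ∃ j, k = i + j + 1 := ⟨k - i - 1, by omega⟩
          rw [show i + j + 1 + 1 - i = j + 1 + 1 by omega, ih (j + 1) (by omega)]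
          simp
  rw [← qInt_zero_left, ← qInt_zero_left]
  ext1 k
  rw [← shiftCoeff_apply]
  rcases k with _ | k
  · simp [shiftCoeff_zero]
  · rw [key, Polynomial.coeff_sub, Polynomial.coeff_X_mul, Polynomial.coeff_C_succ,
      Polynomial.coeff_C]
    split_ifs <;> simp

/-- the Hall–Littlewood functions `Q_λ(x;t)`, for a list `λ` of parts -/
def hlQ (t : K) : List ℕ → SymF
  | [] => 1
  | m :: l => creation t m (hlQ t l)

/-- `b_λ(t)`, for a decreasing list `λ` of parts -/
def hlB (t : K) : List ℕ → K
  | [] => 1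
  | m :: l => (1 - t ^ (m :: l).count m) * hlB t l

theorem hlB_ne_zero {t : K} (ht : ∀ k : ℕ, 1 - t ^ (k + 1) ≠ 0) (l : List ℕ) :
    hlB t l ≠ 0 := by
  induction l with
  | nil => simp [hlB]
  | cons m l ih =>
    rw [hlB, List.count_cons_self]
    exact mul_ne_zero (ht _) ih

theorem hlB_eq_prod (t : K) (l : List ℕ) :
    hlB t l = ∏ i ∈ l.toFinset, ∏ k ∈ Finset.range (l.count i), (1 - t ^ (k + 1)) := by
  induction l with
  | nil => simp [hlB]
  | cons m l ih =>
    have h1 : ∏ i ∈ l.toFinset, ∏ k ∈ Finset.range (l.count i), (1 - t ^ (k + 1)) =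
        ∏ i ∈ insert m l.toFinset, ∏ k ∈ Finset.range (l.count i), (1 - t ^ (k + 1)) := by
      refine Finset.prod_subset (Finset.subset_insert _ _) fun i _ hi => ?_
      rw [List.count_eq_zero.2 (by simpa using hi)]
      simp
    have hm : m ∈ insert m l.toFinset := Finset.mem_insert_self _ _
    have h2 : ∏ i ∈ (insert m l.toFinset).erase m,
          ∏ k ∈ Finset.range ((m :: l).count i), (1 - t ^ (k + 1)) =
        ∏ i ∈ (insert m l.toFinset).erase m, ∏ k ∈ Finset.range (l.count i), (1 - t ^ (k + 1)) := by
      refine Finset.prod_congr rfl fun i hi => ?_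
      rw [List.count_cons_of_ne (Finset.ne_of_mem_erase hi).symm]
    rw [hlB, ih, h1, List.toFinset_cons, ← Finset.mul_prod_erase _ _ hm,
      ← Finset.mul_prod_erase _ _ hm, h2, List.count_cons_self, Finset.prod_range_succ]
    ring

theorem hlQ_isWeightedHomogeneous (t : K) (l : List ℕ) :
    (hlQ t l).IsWeightedHomogeneous wtZ (l.sum : ℕ) := by
  induction l with
  | nil => simpa [hlQ] using isWeightedHomogeneous_one K wtZ
  | cons m l ih =>
    rw [List.sum_cons, Nat.cast_add]
    exact creation_isWeightedHomogeneous t m ih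

theorem shiftCoeff_eq_zero {ε : K} {k : ℕ} {f : SymF} (h : (shift ε f).natDegree < k) :
    shiftCoeff ε k f = 0 := Polynomial.coeff_eq_zero_of_natDegree_lt h

theorem natDegree_shift_creation_le {t : K} (ht : ∀ k : ℕ, 1 - t ^ (k + 1) ≠ 0) {m : ℕ} {f : SymF}
    (hf : (shift 1 f).natDegree ≤ m) : (shift 1 (creation t m f)).natDegree ≤ m := by
  rw [Polynomial.natDegree_le_iff_coeff_eq_zero]
  intro k hk
  rw [← shiftCoeff_apply, shiftCoeff_creation_of_natDegree_le ht _ (hf.trans hk.le),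
    shiftCoeff_eq_zero (hf.trans_lt hk), qInt_of_neg t (by omega)]
  simp

theorem shiftCoeff_creation_self {t : K} (ht : ∀ k : ℕ, 1 - t ^ (k + 1) ≠ 0) {m : ℕ} {f : SymF}
    (hf : (shift 1 f).natDegree ≤ m) :
    shiftCoeff 1 m (creation t m f) = t • creation t m (shiftCoeff 1 m f) + (1 - t) • f := by
  rw [shiftCoeff_creation_of_natDegree_le ht _ hf, sub_self, qInt_zero, mul_one]

theorem shift_hlQ_cons {t : K} (ht : ∀ k : ℕ, 1 - t ^ (k + 1) ≠ 0) {m : ℕ} {l : List ℕ}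
    (hs : (m :: l).Pairwise (· ≥ ·)) (hpos : ∀ x ∈ m :: l, 0 < x) :
    (shift 1 (hlQ t (m :: l))).natDegree ≤ m ∧
      shiftCoeff 1 m (hlQ t (m :: l)) = (1 - t ^ (m :: l).count m) • hlQ t l := by
  induction l generalizing m with
  | nil =>
    have hm : 0 < m := hpos m (by simp)
    have h0 : (shift 1 (hlQ t [])).natDegree ≤ m := by simp [hlQ]
    refine ⟨natDegree_shift_creation_le ht h0, ?_⟩
    rw [hlQ.eq_2, shiftCoeff_creation_self ht h0, shiftCoeff_eq_zero (by simpa [hlQ] using hm)]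
    simp
  | cons a l ih =>
    obtain ⟨h1, h2⟩ := ih (List.pairwise_cons.1 hs).2 (fun x hx => hpos x (by simp_all))
    have ham : a ≤ m := (List.pairwise_cons.1 hs).1 a (by simp)
    refine ⟨natDegree_shift_creation_le ht (h1.trans ham), ?_⟩
    rw [hlQ.eq_2, shiftCoeff_creation_self ht (h1.trans ham), List.count_cons_self]
    rcases ham.eq_or_lt with rfl | hlt
    · rw [h2, map_smul]
      change t • (1 - t ^ _) • hlQ t (a :: l) + _ = _
      rw [pow_succ]
      rw [smul_smul, ← add_smul]
      congr 1
      ring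
    · rw [shiftCoeff_eq_zero (h1.trans_lt hlt), List.count_eq_zero.2]
      · simp
      · intro hm
        rcases List.mem_cons.1 hm with h | h
        · omega
        · have := (List.pairwise_cons.1 (List.pairwise_cons.1 hs).2).1 m h
          omega

theorem pairing_creation {t : K} (ht : ∀ k : ℕ, 1 - t ^ (k + 1) ≠ 0) {m : ℕ} (f : SymF) {g : SymF}
    (hg : (shift 1 g).natDegree ≤ m) :
    pairing t (creation t m f) g = pairing t f (shiftCoeff 1 m g) := by
  rw [creation_eq_sum t m f (Nat.lt_succ_self _), map_sum, LinearMap.sum_apply,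
    Finset.sum_eq_single 0]
  · rw [shiftCoeff_zero, mul_comm, ← pairing_qInt_mul ht]
    simp
  · intro s _ hs
    rw [mul_comm, show (m : ℤ) + s = ((m + s : ℕ) : ℤ) by simp, pairing_qInt_mul ht,
      shiftCoeff_eq_zero (k := m + s) (f := g) (by omega), map_zero]
  · simp

theorem pairing_creation_eq_zero {t : K} (ht : ∀ k : ℕ, 1 - t ^ (k + 1) ≠ 0) {m : ℕ} (f : SymF)
    {g : SymF} (hg : (shift 1 g).natDegree < m) : pairing t (creation t m f) g = 0 := by
  rw [pairing_creation ht f hg.le, shiftCoeff_eq_zero hg, map_zero]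

theorem pairing_hlQ {t : K} (ht : ∀ k : ℕ, 1 - t ^ (k + 1) ≠ 0) {l l' : List ℕ}
    (hs : l.Pairwise (· ≥ ·)) (hpos : ∀ x ∈ l, 0 < x)
    (hs' : l'.Pairwise (· ≥ ·)) (hpos' : ∀ x ∈ l', 0 < x) :
    pairing t (hlQ t l) (hlQ t l') = if l = l' then hlB t l else 0 := by
  induction l generalizing l' with
  | nil =>
    cases l' with
    | nil => simp [hlQ, hlB, pairing_one_left]
    | cons b l' =>
      rw [pairing_comm, hlQ.eq_2, pairing_creation_eq_zero ht]
      · simp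
      · simpa [hlQ] using hpos' b (by simp)
  | cons a l ih =>
    cases l' with
    | nil =>
      rw [hlQ.eq_2, pairing_creation_eq_zero ht]
      · simp
      · simpa [hlQ] using hpos a (by simp)
    | cons b l' =>
      obtain ⟨h1, -⟩ := shift_hlQ_cons ht hs hpos
      obtain ⟨h1', h2'⟩ := shift_hlQ_cons ht hs' hpos'
      rcases lt_trichotomy a b with h | rfl | h
      · rw [pairing_comm, hlQ.eq_2 t b l', pairing_creation_eq_zero ht _ (h1.trans_lt h), if_neg]
        simp [h.ne]
      · rw [hlQ.eq_2 t a l, pairing_creation ht _ h1', h2', map_smul,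
          ih (List.pairwise_cons.1 hs).2 (fun x hx => hpos x (by simp [hx]))
            (List.pairwise_cons.1 hs').2 (fun x hx => hpos' x (by simp [hx]))]
        by_cases hl : l = l'
        · simp [hl, hlB]
        · simp [hl]
      · rw [hlQ.eq_2 t a l, pairing_creation_eq_zero ht _ (h1'.trans_lt h), if_neg]
        simp [h.ne']

/-- expansion in an orthogonal family indexed by the partitions of `n` -/
theorem eq_sum_pairing_smul {t : K} (ht : ∀ k : ℕ, 1 - t ^ (k + 1) ≠ 0) {n : ℕ}
    {F : n.Partition → SymF} {b : n.Partition → K} (hb : ∀ lam, b lam ≠ 0)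
    (hF : ∀ lam, (F lam).IsWeightedHomogeneous wtZ n)
    (horth : ∀ lam μ, pairing t (F lam) (F μ) = if lam = μ then b lam else 0)
    {f : SymF} (hf : f.IsWeightedHomogeneous wtZ n) :
    f = ∑ lam, (pairing t f (F lam) / b lam) • F lam := by
  let A : Matrix n.Partition n.Partition K := Matrix.of fun lam ρ =>
    coeff (expo ρ) (F lam) * zDef t (expo ρ)
  let B : Matrix n.Partition n.Partition K := Matrix.of fun ρ μ =>
    coeff (expo ρ) (F μ) / b μ
  have hAB : A * B = 1 := by
    ext lam μ
    rw [Matrix.mul_apply, Matrix.one_apply]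
    have h := horth lam μ
    rw [pairing_eq_sum_partition t (hF lam)] at h
    have e : ∑ ρ, A lam ρ * B ρ μ = (∑ ρ : n.Partition, coeff (expo ρ) (F lam) *
        coeff (expo ρ) (F μ) * zDef t (expo ρ)) / b μ := by
      rw [Finset.sum_div]
      exact Finset.sum_congr rfl fun ρ _ => by simp only [A, B, Matrix.of_apply]; ring
    rw [e, h]
    split_ifs with h1
    · rw [h1, div_self (hb μ)]
    · simp
  have hBA : B * A = 1 := mul_eq_one_comm.1 hAB
  have hsum : (∑ lam, (pairing t f (F lam) / b lam) • F lam).IsWeightedHomogeneous wtZ n :=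
    Submodule.sum_mem (weightedHomogeneousSubmodule K wtZ n) fun lam _ =>
      Submodule.smul_mem _ _ (hF lam)
  ext d
  by_cases hd : Finsupp.weight wtZ d = n
  · obtain ⟨σ, rfl⟩ := exists_expo_eq hd
    have hz := zDef_ne_zero ht (expo σ)
    apply mul_right_cancel₀ hz
    rw [coeff_sum, Finset.sum_mul]
    have e : ∀ lam, coeff (expo σ) ((pairing t f (F lam) / b lam) • F lam) * zDef t (expo σ) =
        ∑ ρ : n.Partition, coeff (expo ρ) f * zDef t (expo ρ) * (B ρ lam * A lam σ) := by
      intro lam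
      rw [pairing_eq_sum_partition t hf, coeff_smul, smul_eq_mul, Finset.sum_div, Finset.sum_mul,
        Finset.sum_mul]
      exact Finset.sum_congr rfl fun ρ _ => by simp only [A, B, Matrix.of_apply]; ring
    rw [Finset.sum_congr rfl fun lam _ => e lam, Finset.sum_comm]
    have e2 : ∀ ρ : n.Partition, ∑ lam, B ρ lam * A lam σ = if ρ = σ then 1 else 0 := by
      intro ρ
      rw [← Matrix.mul_apply, hBA, Matrix.one_apply]
    simp only [← Finset.mul_sum, e2]
    simp
  · rw [hf.coeff_eq_zero d hd, hsum.coeff_eq_zero d hd]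

theorem sortedParts_pairwise {n : ℕ} (lam : n.Partition) :
    (sortedParts lam).Pairwise (· ≥ ·) := by
  rw [sortedParts, List.pairwise_reverse]
  exact Multiset.pairwise_sort _ _

theorem coe_sortedParts {n : ℕ} (lam : n.Partition) :
    ((sortedParts lam : List ℕ) : Multiset ℕ) = lam.parts := by
  rw [sortedParts, Multiset.coe_reverse, Multiset.sort_eq]

theorem sortedParts_injective {n : ℕ} : Function.Injective (sortedParts (n := n)) := by
  intro lam μ h
  ext1
  rw [← coe_sortedParts, ← coe_sortedParts, h]

theorem sortedParts_pos {n : ℕ} (lam : n.Partition) : ∀ x ∈ sortedParts lam, 0 < x := by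
  intro x hx
  apply lam.parts_pos
  rwa [← coe_sortedParts]

theorem sortedParts_sum {n : ℕ} (lam : n.Partition) : (sortedParts lam).sum = n := by
  rw [← Multiset.sum_coe, coe_sortedParts, lam.parts_sum]

/-- the expansion of a symmetric function in the Hall–Littlewood functions `Q_λ` -/
theorem eq_sum_hlQ {t : K} (ht : ∀ k : ℕ, 1 - t ^ (k + 1) ≠ 0) {n : ℕ} {f : SymF}
    (hf : f.IsWeightedHomogeneous wtZ n) :
    f = ∑ lam : n.Partition, (pairing t f (hlQ t (sortedParts lam)) / hlB t (sortedParts lam)) •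
      hlQ t (sortedParts lam) := by
  refine eq_sum_pairing_smul ht (fun lam => hlB_ne_zero ht _) (fun lam => ?_)
    (fun lam μ => ?_) hf
  · have := hlQ_isWeightedHomogeneous t (sortedParts lam)
    rwa [sortedParts_sum] at this
  · rw [pairing_hlQ ht (sortedParts_pairwise _) (sortedParts_pos _) (sortedParts_pairwise _)
      (sortedParts_pos _)]
    simp [sortedParts_injective.eq_iff]

/-- the Jacobi–Trudi determinant of a list is built by the creation operators at `t = 0` -/
theorem det_hZ_eq_hlQ (l : List ℕ) :
    Matrix.det (Matrix.of fun i j : Fin l.length => hZ ((l.get i : ℤ) - (i : ℤ) + (j : ℤ))) =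
      hlQ 0 l := by
  induction l with
  | nil => simp [hlQ]
  | cons m l ih =>
    let R : Fin l.length → Fin (l.length + 1) → SymF := fun i j =>
      hZ ((l.get i : ℤ) - ((i : ℤ) + 1) + (j : ℤ))
    let M : Matrix (Fin (l.length + 1)) (Fin (l.length + 1)) (Polynomial SymF) :=
      Matrix.of (Fin.cons (fun j => Polynomial.X ^ (j : ℕ)) fun i j => Polynomial.C (R i j))
    let N : Matrix (Fin (l.length + 1)) (Fin (l.length + 1)) (Polynomial SymF) :=
      Matrix.of fun i => Fin.cons (M i 0) fun j =>
        M i j.succ - Polynomial.X * M i (Fin.castSucc j)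
    have hMN : M.det = N.det := by
      refine Matrix.det_eq_of_forall_col_eq_smul_add_pred (fun _ => Polynomial.X) ?_ ?_
      · intro i
        rfl
      · intro i j
        simp [N]
    have hM : shift (-1) (hlQ 0 l) = M.det := by
      rw [hMN, Matrix.det_succ_row_zero, Fin.sum_univ_succ, Finset.sum_eq_zero, ← ih,
        RingHom.map_det]
      · simp only [N, M]
        simp
        congr 1
        ext1 i j
        simp only [Matrix.map_apply, Matrix.of_apply,
          Matrix.submatrix_apply, shift_neg_one_hZ]
        simp [R]
        congr 2 <;> congr 1 <;> ring_nf
      · intro j _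
        simp [N, M, pow_succ']
    rw [hlQ.eq_2, creation_apply, hM, Matrix.det_succ_row_zero M, map_sum]
    refine (Matrix.det_succ_row_zero _).trans (Finset.sum_congr rfl fun j _ => ?_)
    have hminor : (M.submatrix Fin.succ j.succAbove).det =
        Polynomial.C (Matrix.det (Matrix.of fun i k => R i (j.succAbove k))) := by
      rw [RingHom.map_det]
      rfl
    have hterm : (-1) ^ (j : ℕ) * M 0 j * (M.submatrix Fin.succ j.succAbove).det =
        Polynomial.C ((-1) ^ (j : ℕ) * Matrix.det (Matrix.of fun i k => R i (j.succAbove k))) *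
          Polynomial.X ^ (j : ℕ) := by
      rw [hminor]
      simp [M]
    rw [hterm, qLin_mul_X_pow, qLin_C, qInt_zero_left, mul_right_comm]
    congr 2

theorem schur_eq_hlQ {n : ℕ} (lam : n.Partition) : schur lam = hlQ 0 (sortedParts lam) :=
  det_hZ_eq_hlQ _

/-- `q_ν(t) = q_{ν_1}(t) q_{ν_2}(t) ⋯` -/
def qProd (t : K) (ν : Multiset ℕ) : SymF := (ν.map fun i : ℕ => qInt t i).prod

theorem qProd_zero (t : K) : qProd t 0 = 1 := by simp [qProd]

theorem qProd_cons (t : K) (a : ℕ) (ν : Multiset ℕ) :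
    qProd t (a ::ₘ ν) = qInt t a * qProd t ν := by simp [qProd]

theorem qProd_isWeightedHomogeneous (t : K) (ν : Multiset ℕ) :
    (qProd t ν).IsWeightedHomogeneous wtZ (ν.sum : ℕ) := by
  induction ν using Multiset.induction_on with
  | empty => simpa [qProd_zero] using isWeightedHomogeneous_one K wtZ
  | cons a ν ih =>
    rw [qProd_cons, Multiset.sum_cons, Nat.cast_add]
    exact (qInt_isWeightedHomogeneous t a).mul ih

theorem pairing_qProd_eq {t : K} (ht : ∀ k : ℕ, 1 - t ^ (k + 1) ≠ 0) (ν : Multiset ℕ) (g : SymF) :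
    pairing t (qProd t ν) g = pairing 0 (qProd 0 ν) g := by
  induction ν using Multiset.induction_on generalizing g with
  | empty => rw [qProd_zero, qProd_zero, pairing_one_left, pairing_one_left]
  | cons a ν ih =>
    rw [qProd_cons, qProd_cons, pairing_qInt_mul ht, pairing_qInt_mul (by simp), ih]

theorem hProd_eq_qProd {n : ℕ} (lam : n.Partition) : hProd lam = qProd 0 lam.parts := by
  simp only [hProd, qProd, qInt_zero_left, hZ, Int.toNat_natCast]
  simp only [Int.natCast_nonneg, not_lt.2, if_false]

theorem adjoin_qInt_eq_top {t : K} (ht : ∀ k : ℕ, 1 - t ^ (k + 1) ≠ 0) :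
    Algebra.adjoin K (Set.range fun r : ℕ => qInt t ((r + 1 : ℕ) : ℤ)) = ⊤ := by
  set A := Algebra.adjoin K (Set.range fun r : ℕ => qInt t ((r + 1 : ℕ) : ℤ))
  have hq : ∀ k : ℕ, qInt t k ∈ A := by
    intro k
    cases k with
    | zero => simp [qInt_zero]
    | succ k => exact Algebra.subset_adjoin ⟨k, rfl⟩
  have hX : ∀ i : ℕ, (X i : SymF) ∈ A := by
    intro i
    induction i using Nat.strong_induction_on with
    | _ i ih =>
      have h := smul_qInt_eq_sum ht (i + 1)
      rw [Finset.sum_range_succ] at h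
      have h0 : qInt t (((i + 1 : ℕ) : ℤ) - (i + 1)) = 1 := by simp [qInt_zero]
      rw [h0, mul_one, ← sub_eq_iff_eq_add'] at h
      have h1 : (1 - t ^ (i + 1)) • (X i : SymF) ∈ A := by
        rw [← h]
        refine A.sub_mem (A.smul_mem (hq _) _) (A.sum_mem fun j hj => A.smul_mem (A.mul_mem
          (ih j (Finset.mem_range.1 hj)) ?_) _)
        have := hq (i - j)
        rw [Nat.cast_sub (Finset.mem_range.1 hj).le] at this
        convert this using 2
        push_cast
        ring
      have h2 := A.smul_mem h1 (1 - t ^ (i + 1))⁻¹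
      rwa [smul_smul, inv_mul_cancel₀ (ht i), one_smul] at h2
  rw [eq_top_iff, ← MvPolynomial.adjoin_range_X]
  refine Algebra.adjoin_le ?_
  rintro _ ⟨i, rfl⟩
  exact hX i

theorem eq_zero_of_pairing_qProd {t : K} (ht : ∀ k : ℕ, 1 - t ^ (k + 1) ≠ 0) {f : SymF}
    (h : ∀ ν : Multiset ℕ, (∀ x ∈ ν, 0 < x) → pairing t (qProd t ν) f = 0) : f = 0 := by
  refine eq_zero_of_pairing ht fun g => ?_
  have hg : g ∈ Subalgebra.toSubmodule
      (Algebra.adjoin K (Set.range fun r : ℕ => qInt t ((r + 1 : ℕ) : ℤ))) := by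
    rw [adjoin_qInt_eq_top ht]
    trivial
  rw [Algebra.adjoin_eq_span] at hg
  induction hg using Submodule.span_induction with
  | zero => simp
  | add x y _ _ hx hy => rw [map_add, LinearMap.add_apply, hx, hy, add_zero]
  | smul a x _ hx => rw [map_smul, LinearMap.smul_apply, hx, smul_zero]
  | mem x hx =>
    have key : ∃ ν : Multiset ℕ, (∀ x ∈ ν, 0 < x) ∧ qProd t ν = x := by
      induction hx using Submonoid.closure_induction with
      | one => exact ⟨0, by simp, qProd_zero t⟩
      | mem x hx =>
        obtain ⟨r, rfl⟩ := hx
        exact ⟨{r + 1}, by simp, by simp [qProd]⟩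
      | mul x y _ _ hx hy =>
        obtain ⟨ν, h1, rfl⟩ := hx
        obtain ⟨κ, h2, rfl⟩ := hy
        refine ⟨ν + κ, fun x hx => ?_, by simp [qProd]⟩
        rcases Multiset.mem_add.1 hx with hx | hx
        exacts [h1 x hx, h2 x hx]
    obtain ⟨ν, h1, rfl⟩ := key
    exact h ν h1

/-- only monomial functions `m_ν` with `ν` dominated by `l` occur in `g` -/
def DomBy (t : K) (g : SymF) (l : List ℕ) : Prop :=
  ∀ ν : Multiset ℕ, (∀ x ∈ ν, 0 < x) → pairing t (qProd t ν) g ≠ 0 →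
    ∀ β ≤ ν, β.sum ≤ (l.take (Multiset.card β)).sum

theorem pairing_qProd_shiftCoeff {t : K} (ht : ∀ k : ℕ, 1 - t ^ (k + 1) ≠ 0) (ν : Multiset ℕ)
    (k : ℕ) (g : SymF) :
    pairing t (qProd t ν) (shiftCoeff 1 k g) = pairing t (qProd t (k ::ₘ ν)) g := by
  rw [qProd_cons, pairing_qInt_mul ht]

theorem DomBy.natDegree_le {t : K} (ht : ∀ k : ℕ, 1 - t ^ (k + 1) ≠ 0) {g : SymF} {l : List ℕ}
    (h : DomBy t g l) : (shift 1 g).natDegree ≤ (l.take 1).sum := by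
  rw [Polynomial.natDegree_le_iff_coeff_eq_zero]
  intro k hk
  refine eq_zero_of_pairing_qProd ht fun ν hν => ?_
  by_contra hne
  rw [← shiftCoeff_apply, pairing_qProd_shiftCoeff ht] at hne
  have := h (k ::ₘ ν) (by simpa using ⟨by omega, hν⟩) hne {k} (by simp)
  simp at this
  omega

theorem DomBy.tail {t : K} (ht : ∀ k : ℕ, 1 - t ^ (k + 1) ≠ 0) {g : SymF} {m : ℕ} {l : List ℕ}
    (hm : 0 < m) (h : DomBy t g (m :: l)) : DomBy t (shiftCoeff 1 m g) l := by
  intro ν hν hne β hβ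
  rw [pairing_qProd_shiftCoeff ht] at hne
  have := h (m ::ₘ ν) (by simpa using ⟨hm, hν⟩) hne (m ::ₘ β) (Multiset.cons_le_cons m hβ)
  simpa using this

theorem DomBy.pairing_hlQ_self {t : K} (ht : ∀ k : ℕ, 1 - t ^ (k + 1) ≠ 0) {g : SymF} {l : List ℕ}
    (hl : ∀ x ∈ l, 0 < x) (h : DomBy t g l) :
    pairing t (hlQ t l) g = pairing t (qProd t l) g := by
  induction l generalizing g with
  | nil => simp [hlQ, qProd_zero]
  | cons m l ih =>
    have hdeg := h.natDegree_le ht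
    simp only [List.take_succ_cons, List.take_zero, List.sum_singleton] at hdeg
    rw [hlQ.eq_2, pairing_creation ht _ hdeg,
      ih (fun x hx => hl x (by simp [hx])) (h.tail ht (hl m (by simp))),
      pairing_qProd_shiftCoeff ht, Multiset.cons_coe]

theorem DomBy.pairing_hlQ_eq_zero {t : K} (ht : ∀ k : ℕ, 1 - t ^ (k + 1) ≠ 0) {g : SymF}
    {l l' : List ℕ} (hl : ∀ x ∈ l, 0 < x) (hlt : l' < l) (h : DomBy t g l') :
    pairing t (hlQ t l) g = 0 := by
  have hdeg := h.natDegree_le ht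
  induction hlt generalizing g with
  | nil =>
    rw [hlQ.eq_2, pairing_creation_eq_zero ht]
    exact lt_of_le_of_lt hdeg (by simpa using hl _ (by simp))
  | rel hab =>
    rw [hlQ.eq_2, pairing_creation_eq_zero ht]
    exact lt_of_le_of_lt hdeg (by simpa using hab)
  | cons _ ih =>
    rw [hlQ.eq_2, pairing_creation ht _ (by simpa using hdeg)]
    have h' := h.tail ht (hl _ (by simp))
    exact ih (fun x hx => hl x (by simp [hx])) h' (h'.natDegree_le ht)

theorem sum_take_le_sum_take_cons {a : ℕ} {l : List ℕ} (h : ∀ x ∈ l, x ≤ a) (c : ℕ) :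
    (l.take c).sum ≤ ((a :: l).take c).sum := by
  cases c with
  | zero => simp
  | succ c =>
    rw [List.take_succ_cons, List.take_add_one, List.sum_append, List.sum_cons, add_comm]
    refine Nat.add_le_add_right ?_ _
    cases hc : l[c]? with
    | none => simp
    | some x => simpa using h x (List.mem_of_getElem? hc)

/-- a sub-multiset of a decreasing list has sum at most that of the initial segment -/
theorem sum_le_sum_take {l : List ℕ} (hl : l.Pairwise (· ≥ ·)) {β : Multiset ℕ}
    (hβ : β ≤ (l : Multiset ℕ)) : β.sum ≤ (l.take (Multiset.card β)).sum := by
  induction l generalizing β with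
  | nil =>
    have : β = 0 := by simpa using hβ
    simp [this]
  | cons a l ih =>
    obtain ⟨h1, h2⟩ := List.pairwise_cons.1 hl
    rw [← Multiset.cons_coe] at hβ
    by_cases ha : a ∈ β
    · obtain ⟨γ, rfl⟩ := Multiset.exists_cons_of_mem ha
      have := ih h2 ((Multiset.cons_le_cons_iff a).1 hβ)
      simpa using this
    · exact (ih h2 ((Multiset.le_cons_of_notMem ha).1 hβ)).trans
        (sum_take_le_sum_take_cons h1 _)

theorem isWeightedHomogeneous_wtZ {f : SymF} {n : ℕ}
    (hf : f.IsWeightedHomogeneous (fun i => i + 1) n) : f.IsWeightedHomogeneous wtZ (n : ℤ) := by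
  intro d hd
  have := hf hd
  rw [Finsupp.weight_apply, Finsupp.sum] at this ⊢
  rw [← this]
  simp [wtZ]

theorem one_sub_q_pow_ne_zero (k : ℕ) : 1 - q ^ (k + 1) ≠ 0 := by
  have h : (1 : K) - q ^ (k + 1) =
      algebraMap (Polynomial ℚ) K (1 - Polynomial.X ^ (k + 1)) := by
    simp [q, RatFunc.algebraMap_X]
  rw [h, Ne, map_eq_zero_iff _ (RatFunc.algebraMap_injective ℚ)]
  intro h0
  have := congrArg (Polynomial.coeff · 0) h0
  simp at this

theorem IsHLBasis.domBy {n : ℕ} {P : n.Partition → SymF} (hP : IsHLBasis n P)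
    (lam : n.Partition) : DomBy q (P lam) (sortedParts lam) := by
  intro ν hν hne β hβ
  have hsum : ν.sum = n := by
    by_contra h
    exact hne (pairing_eq_zero_of_weight_ne q (qProd_isWeightedHomogeneous q ν)
      (isWeightedHomogeneous_wtZ (hP.homog lam)) (by exact_mod_cast h))
  let μ : n.Partition := ⟨ν, fun {i} hi => hν i hi, hsum⟩
  have hdom : dominates μ lam := by
    apply hP.triangular
    rw [hall_eq, pairing_comm, hProd_eq_qProd, ← pairing_qProd_eq one_sub_q_pow_ne_zero]
    exact hne
  refine (sum_le_sum_take (sortedParts_pairwise μ) ?_).trans (hdom _)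
  rw [coe_sortedParts]
  exact hβ

theorem IsHLBasis.pairing_qProd_self {n : ℕ} {P : n.Partition → SymF} (hP : IsHLBasis n P)
    (lam : n.Partition) : pairing q (qProd q lam.parts) (P lam) = 1 := by
  rw [pairing_qProd_eq one_sub_q_pow_ne_zero, ← hProd_eq_qProd, pairing_comm, ← hall_eq, hP.diag]

/-- uniqueness of the Hall–Littlewood functions: `P_λ = b_λ⁻¹ Q_λ` -/
theorem IsHLBasis.eq_smul_hlQ {n : ℕ} {P : n.Partition → SymF} (hP : IsHLBasis n P)
    (lam : n.Partition) :
    P lam = (hlB q (sortedParts lam))⁻¹ • hlQ q (sortedParts lam) := by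
  have hwf : WellFounded (fun lam μ : n.Partition => sortedParts lam < sortedParts μ) := by
    have : IsTrans n.Partition (fun lam μ => sortedParts lam < sortedParts μ) :=
      ⟨fun _ _ _ h1 h2 => lt_trans h1 h2⟩
    have : Std.Irrefl (fun lam μ : n.Partition => sortedParts lam < sortedParts μ) :=
      ⟨fun _ h => lt_irrefl _ h⟩
    exact Finite.wellFounded_of_trans_of_irrefl _
  induction lam using hwf.induction with
  | _ lam ih =>
    have hexp := eq_sum_hlQ one_sub_q_pow_ne_zero (isWeightedHomogeneous_wtZ (hP.homog lam))
    rw [Finset.sum_eq_single lam] at hexp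
    · rw [pairing_comm, (hP.domBy lam).pairing_hlQ_self one_sub_q_pow_ne_zero (sortedParts_pos lam),
        coe_sortedParts, hP.pairing_qProd_self, one_div] at hexp
      exact hexp
    · intro μ _ hμ
      have h0 : pairing q (P lam) (hlQ q (sortedParts μ)) = 0 := by
        rcases lt_trichotomy (sortedParts μ) (sortedParts lam) with h | h | h
        · have horth := hP.orth lam μ hμ.symm
          rw [hallT_eq, ih μ h, map_smul, smul_eq_mul] at horth
          exact (mul_eq_zero.1 horth).resolve_left
            (inv_ne_zero (hlB_ne_zero one_sub_q_pow_ne_zero _))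
        · exact absurd (sortedParts_injective h) hμ
        · rw [pairing_comm]
          exact (hP.domBy lam).pairing_hlQ_eq_zero one_sub_q_pow_ne_zero (sortedParts_pos μ) h
      rw [h0, zero_div, zero_smul]
    · simp

theorem IsHLBasis.pairing_eq {n : ℕ} {P : n.Partition → SymF} (hP : IsHLBasis n P)
    (lam μ : n.Partition) :
    pairing q (P lam) (P μ) = if lam = μ then (hlB q (sortedParts lam))⁻¹ else 0 := by
  split_ifs with h
  · subst h
    have hb := hlB_ne_zero one_sub_q_pow_ne_zero (sortedParts lam)
    rw [hP.eq_smul_hlQ, map_smul, map_smul, LinearMap.smul_apply,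
      pairing_hlQ one_sub_q_pow_ne_zero (sortedParts_pairwise _) (sortedParts_pos _)
        (sortedParts_pairwise _) (sortedParts_pos _)]
    simp [hb]
  · rw [← hallT_eq, hP.orth _ _ h]

theorem pP_isWeightedHomogeneous {n : ℕ} (ρ : n.Partition) :
    (pP ρ).IsWeightedHomogeneous wtZ n := by
  rw [pP_eq_monomial]
  exact isWeightedHomogeneous_monomial _ _ _ (weight_expo ρ)

theorem hlB_zero_left (l : List ℕ) : hlB 0 l = 1 := by
  induction l with
  | nil => rfl
  | cons m l ih => simp [hlB, ih]

/-- the Frobenius character formula -/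
theorem pP_eq_sum_schur {n : ℕ} (ρ : n.Partition) :
    pP ρ = ∑ μ : n.Partition, chiS μ ρ • schur μ := by
  refine (eq_sum_hlQ (t := 0) (by simp) (pP_isWeightedHomogeneous ρ)).trans
    (Finset.sum_congr rfl fun μ _ => ?_)
  rw [hlB_zero_left, div_one, ← schur_eq_hlQ, pairing_comm, chiS, hall_eq]

theorem pairing_pP (t : K) {n : ℕ} (ρ σ : n.Partition) :
    pairing t (pP ρ) (pP σ) = if ρ = σ then zDef t (expo ρ) else 0 := by
  rw [pP_eq_monomial, pP_eq_monomial, pairing_monomial_left, coeff_monomial]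
  by_cases h : ρ = σ
  · simp [h]
  · simp [h, expo_injective.eq_iff, Ne.symm h]

theorem map_pP (φ : K →+* K) {n : ℕ} (ρ : n.Partition) : MvPolynomial.map φ (pP ρ) = pP ρ := by
  rw [pP_eq_monomial, map_monomial, map_one]

theorem map_hZ (φ : K →+* K) (m : ℤ) : MvPolynomial.map φ (hZ m) = hZ m := by
  rw [hZ]
  split_ifs
  · simp
  · rw [hP, map_sum]
    refine Finset.sum_congr rfl fun ρ _ => ?_
    rw [MvPolynomial.smul_eq_C_mul, map_mul, map_C, map_pP, map_inv₀, map_natCast]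

theorem map_schur (φ : K →+* K) {n : ℕ} (μ : n.Partition) :
    MvPolynomial.map φ (schur μ) = schur μ := by
  rw [schur, RingHom.map_det]
  congr 1
  ext1 i j
  simp [map_hZ]

theorem map_chiS (φ : K →+* K) {n : ℕ} (μ ρ : n.Partition) : φ (chiS μ ρ) = chiS μ ρ := by
  rw [chiS, hall_eq, pairing_comm, pP_eq_monomial, pairing_monomial_left, zDef_zero_left, zMon_expo,
    map_mul, map_mul, map_one, map_natCast, ← MvPolynomial.coeff_map, map_schur]

theorem greenQ_eq {n : ℕ} (Kst : n.Partition → n.Partition → K) (invq : K →+* K)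
    (lam ρ : n.Partition) :
    greenQ Kst invq lam ρ = q ^ nStat lam * invq (∑ μ, chiS μ ρ * Kst μ lam) := by
  rw [greenQ, map_sum, Finset.mul_sum]
  refine Finset.sum_congr rfl fun μ _ => ?_
  rw [Ktilde, map_mul, map_chiS]
  ring

theorem aP_eq {n : ℕ} {invq : K →+* K} (hinvq : invq q = q⁻¹) (lam : n.Partition) :
    aP lam = q ^ (n + 2 * nStat lam) * invq (hlB q (sortedParts lam)) := by
  rw [aP, hlB_eq_prod, map_prod, ← coe_sortedParts]
  simp [hinvq]

theorem yP_eq {n : ℕ} {invq : K →+* K} (hinvq : invq q = q⁻¹) (ρ : n.Partition) :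
    yP ρ = q⁻¹ ^ n * invq (zDef q (expo ρ)) := by
  rw [yP, zDef, zMon_expo, map_mul, map_natCast, mul_assoc, Finset.prod_multiset_map_count,
    prod_toFinset_parts, map_prod]
  congr 2
  refine Finset.prod_congr rfl fun i _ => ?_
  rw [expo_apply]
  simp [hinvq]

theorem sum_coeff_mul_coeff {n : ℕ} {P : n.Partition → SymF} (hP : IsHLBasis n P)
    {Kst : n.Partition → n.Partition → K}
    (hKst : ∀ μ : n.Partition, schur μ = ∑ lam : n.Partition, Kst μ lam • P lam)
    (ρ σ : n.Partition) :
    ∑ lam, (hlB q (sortedParts lam))⁻¹ * (∑ μ, chiS μ ρ * Kst μ lam) *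
      (∑ μ, chiS μ σ * Kst μ lam) = if ρ = σ then zDef q (expo ρ) else 0 := by
  have hexp : ∀ τ : n.Partition, pP τ = ∑ lam, (∑ μ, chiS μ τ * Kst μ lam) • P lam := by
    intro τ
    rw [pP_eq_sum_schur τ]
    simp only [hKst, Finset.smul_sum, Finset.sum_smul, smul_smul]
    exact Finset.sum_comm
  rw [← pairing_pP, hexp ρ, hexp σ, map_sum]
  refine Finset.sum_congr rfl fun lam _ => ?_
  rw [map_smul, map_sum, LinearMap.sum_apply]
  simp [hP.pairing_eq]
  ring

open Classical in
theorem green_polynomial_orthogonality (n : ℕ)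
    (P : n.Partition → SymF) (hP : IsHLBasis n P)
    (Kst : n.Partition → n.Partition → K)
    (hKst : ∀ μ : n.Partition, schur μ = ∑ lam : n.Partition, Kst μ lam • P lam)
    (invq : K →+* K) (hinvq : invq RatFunc.X = (RatFunc.X)⁻¹)
    (ρ σ : n.Partition) :
    ∑ lam : n.Partition,
        HsH lam * greenQ Kst invq lam ρ * greenQ Kst invq lam σ
      = if ρ = σ then yP ρ else 0 := by
  change invq q = q⁻¹ at hinvq
  have hq : q ≠ 0 := RatFunc.X_ne_zero
  have hsum := congrArg invq (sum_coeff_mul_coeff hP hKst ρ σ)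
  rw [map_sum] at hsum
  have hy : (if ρ = σ then yP ρ else 0) =
      q⁻¹ ^ n * invq (if ρ = σ then zDef q (expo ρ) else 0) := by
    split_ifs
    · exact yP_eq hinvq ρ
    · simp
  rw [hy]
  convert congrArg (q⁻¹ ^ n * ·) hsum using 1
  rw [Finset.mul_sum]
  refine Finset.sum_congr rfl fun lam _ => ?_
  rw [HsH, aP_eq hinvq, greenQ_eq, greenQ_eq, map_mul, map_mul, map_inv₀, mul_inv]
  have hpow : (q ^ (n + 2 * nStat lam))⁻¹ * q ^ nStat lam * q ^ nStat lam = q⁻¹ ^ n := by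
    rw [inv_pow, pow_add, two_mul, pow_add]
    field_simp
  rw [← hpow]
  ring
end
end
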